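/- arXiv:1709.00858 — 2 statements merged into one kernel-verified Lean document; each statement's English description precedes it below -/
import Mathlib

section
/- Let Σ be a finite alphabet and X ⊆ Σ^ℤ an uncountable sofic shift. Then there is an injective group homomorphism from A_5 ⟅^P ℤ into Aut(X), where P = {1, 2, 3, …} is the set of all positive integers. -/
def shiftMapZ (A : Type*) : (ℤ → A) → (ℤ → A) := fun x i => x (i + 1)

/-- `f` is continuous and commutes (on the subset `X`) with every map in `S`. -/
def GoodPerm {A : Type*} [TopologicalSpace A] {X : Set A} (S : Set (A → A))
    (f : Equiv.Perm X) : Prop :=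
  Continuous ⇑f ∧ ∀ s ∈ S, ∀ x y : X, s ↑x = ↑y → s ↑(f x) = ↑(f y)

theorem GoodPerm.mul {A : Type*} [TopologicalSpace A] {X : Set A} {S : Set (A → A)}
    {f g : Equiv.Perm X} (hf : GoodPerm S f) (hg : GoodPerm S g) : GoodPerm S (f * g) := by
  refine ⟨by simpa [Equiv.Perm.coe_mul] using hf.1.comp hg.1, fun s hs x y hxy => ?_⟩
  simp only [Equiv.Perm.mul_apply]
  exact hf.2 s hs _ _ (hg.2 s hs x y hxy)

theorem GoodPerm.one {A : Type*} [TopologicalSpace A] {X : Set A} {S : Set (A → A)} :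
    GoodPerm (X := X) S 1 :=
  ⟨by simpa [Equiv.Perm.coe_one] using continuous_id, fun _ _ _ _ h => h⟩

/-- The automorphism group of `X`: homeomorphisms of `X` commuting with (the restriction to
`X` of) every map in `S`. -/
def SubAut {A : Type*} [TopologicalSpace A] (X : Set A) (S : Set (A → A)) :
    Subgroup (Equiv.Perm X) where
  carrier := {f | GoodPerm S f ∧ GoodPerm S f⁻¹}
  one_mem' := ⟨GoodPerm.one, by rw [inv_one]; exact GoodPerm.one⟩
  mul_mem' := fun hf hg => ⟨hf.1.mul hg.1, by rw [mul_inv_rev]; exact hg.2.mul hf.2⟩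
  inv_mem' := fun hf => ⟨hf.2, by rw [inv_inv]; exact hf.1⟩

/-- `X` is a sofic shift: a closed shift-invariant subset of the full shift defined by
forbidding the words of a regular language `L`. -/
def IsSoficShift {Γ : Type} [TopologicalSpace Γ] (X : Set (ℤ → Γ)) : Prop :=
  IsClosed X ∧ shiftMapZ Γ '' X = X ∧
    ∃ L : Language Γ, L.IsRegular ∧
      X = {x | ∀ (i : ℤ) (k : ℕ), ((List.range (k + 1)).map fun t => x (i + t)) ∉ L}

/-- The alternating group on five letters. -/
abbrev A5 : Type := alternatingGroup (Fin 5)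

/-- The disjoint union `⨆_{n ∈ N} G^n`. -/
abbrev SN (G : Type*) (N : Set ℕ) : Type _ := Σ n : N, Fin (n : ℕ) → G

/-- The permutation of `⨆_{n ∈ N} G^n` multiplying the first coordinate on the left by `a`. -/
def rho {G : Type*} [Group G] {N : Set ℕ} (a : G) : Equiv.Perm (SN G N) :=
  Equiv.sigmaCongrRight fun _n =>
    Equiv.piCongrRight fun i => if (i : ℕ) = 0 then Equiv.mulLeft a else Equiv.refl G

/-- The permutation of `⨆_{n ∈ N} G^n` rotating each tuple:
`(g_1, …, g_n) ↦ (g_2, …, g_n, g_1)`. -/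
def rot (G : Type*) (N : Set ℕ) : Equiv.Perm (SN G N) :=
  Equiv.sigmaCongrRight fun n => (Equiv.arrowCongr (finRotate (n : ℕ)) (Equiv.refl G)).symm

/-- The group `G ⟅^N ℤ`: the subgroup of permutations of `⨆_{n ∈ N} G^n` generated by the
rotation `↻` together with the `ρ_a`, `a ∈ G`. -/
def WreathZ (G : Type*) [Group G] (N : Set ℕ) : Subgroup (Equiv.Perm (SN G N)) :=
  Subgroup.closure (insert (rot G N) (Set.range (rho (G := G) (N := N))))

theorem rot_mem {G : Type*} [Group G] {N : Set ℕ} : rot G N ∈ WreathZ G N :=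
  Subgroup.subset_closure (Set.mem_insert _ _)

theorem rho_mem {G : Type*} [Group G] {N : Set ℕ} (a : G) :
    rho (G := G) (N := N) a ∈ WreathZ G N :=
  Subgroup.subset_closure (Set.mem_insert_of_mem _ ⟨a, rfl⟩)


/-! ### Systems: a permutation `τ` of sites and a set `B` of marked sites -/

section Systems

variable {G : Type} [Group G]

open Classical in
/-- Generators acting on labelings `S → G`. -/
noncomputable def genS {S : Type} (τ : Equiv.Perm S) (B : Set S) :
    Option G → Equiv.Perm (S → G)
  | none =>
    { toFun := fun f s => f (τ s)
      invFun := fun f s => f (τ⁻¹ s)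
      left_inv := fun f => by funext s; simp
      right_inv := fun f => by funext s; simp }
  | some a =>
    { toFun := fun f s => if s ∈ B then a * f s else f s
      invFun := fun f s => if s ∈ B then a⁻¹ * f s else f s
      left_inv := fun f => by funext s; by_cases h : s ∈ B <;> simp [h]
      right_inv := fun f => by funext s; by_cases h : s ∈ B <;> simp [h] }

/-- The action of the free group. -/
noncomputable def ThetaS {S : Type} (τ : Equiv.Perm S) (B : Set S) :
    FreeGroup (Option G) →* Equiv.Perm (S → G) :=
  FreeGroup.lift (genS τ B)

/-- Visit pattern of a site. -/
def patt {S : Type} (τ : Equiv.Perm S) (B : Set S) (s : S) : Set ℤ := {m | (τ ^ m) s ∈ B}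

theorem patt_zpow {S : Type} (τ : Equiv.Perm S) (B : Set S) (s : S) (k : ℤ) :
    patt τ B ((τ ^ k) s) = {m | m + k ∈ patt τ B s} := by
  ext m
  simp [patt, zpow_add]

/-- The normal form statement. -/
def NF (w : FreeGroup (Option G)) (k : ℤ) (c : Set ℤ → G) (l : ℕ) : Prop :=
  (∀ β β' : Set ℤ, (∀ m : ℤ, |m| ≤ l → (m ∈ β ↔ m ∈ β')) → c β = c β') ∧
  ∀ (S : Type) (τ : Equiv.Perm S) (B : Set S) (f : S → G) (s : S),
    ThetaS τ B w f s = c (patt τ B s) * f ((τ ^ k) s)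

theorem NF.mul {w w' : FreeGroup (Option G)} {k k' : ℤ} {c c' : Set ℤ → G} {l l' : ℕ}
    (h : NF w k c l) (h' : NF w' k' c' l') :
    NF (w * w') (k + k') (fun β => c β * c' {m | m + k ∈ β}) (l + l' + k.natAbs) := by
  refine ⟨fun β β' hβ => ?_, fun S τ B f s => ?_⟩
  · simp only
    rw [h.1 β β' (fun m hm => hβ m (by push_cast; have := abs_nonneg k; omega)),
      h'.1 {m | m + k ∈ β} {m | m + k ∈ β'} (fun m hm => hβ (m + k) (by
        push_cast
        have := abs_add_le m k
        omega))]
  · rw [map_mul, Equiv.Perm.mul_apply, h.2, h'.2, patt_zpow, mul_assoc,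
      ← Equiv.Perm.mul_apply, ← zpow_add, add_comm k' k]

theorem NF.inv {w : FreeGroup (Option G)} {k : ℤ} {c : Set ℤ → G} {l : ℕ}
    (h : NF w k c l) :
    NF w⁻¹ (-k) (fun β => (c {m | m + -k ∈ β})⁻¹) (l + k.natAbs) := by
  refine ⟨fun β β' hβ => ?_, fun S τ B f s => ?_⟩
  · simp only
    rw [h.1 {m | m + -k ∈ β} {m | m + -k ∈ β'} (fun m hm => hβ (m + -k) (by
        push_cast
        have := abs_add_le m (-k)
        have := abs_neg k
        omega))]
  · rw [map_inv]
    have key : ∀ s, c (patt τ B s) * ((ThetaS τ B w)⁻¹ f) ((τ ^ k) s) = f s := by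
      intro s
      rw [← h.2 S τ B ((ThetaS τ B w)⁻¹ f) s]
      simp
    have := key ((τ ^ (-k)) s)
    rw [patt_zpow] at this
    rw [← this]
    simp [← mul_assoc]

theorem exists_NF (w : FreeGroup (Option G)) : ∃ k c l, NF w k c l := by
  classical
  induction w using FreeGroup.induction_on with
  | C1 =>
    exact ⟨0, fun _ => 1, 0, fun _ _ _ => rfl, fun S τ B f s => by simp⟩
  | of x =>
    cases x with
    | none =>
      exact ⟨1, fun _ => 1, 0, fun _ _ _ => rfl, fun S τ B f s => by simp [ThetaS, genS]⟩
    | some a =>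
      refine ⟨0, fun β => if (0 : ℤ) ∈ β then a else 1, 0, fun β β' h => ?_, fun S τ B f s => ?_⟩
      · have := h 0 (by simp)
        simp [this]
      · by_cases h : s ∈ B <;> simp [ThetaS, genS, patt, h]
  | inv_of x ih =>
    obtain ⟨k, c, l, h⟩ := ih
    exact ⟨_, _, _, h.inv⟩
  | mul x y hx hy =>
    obtain ⟨k, c, l, h⟩ := hx
    obtain ⟨k', c', l', h'⟩ := hy
    exact ⟨_, _, _, h.mul h'⟩

theorem NF.trivial {w : FreeGroup (Option G)} {k : ℤ} {c : Set ℤ → G} {l : ℕ} [Nontrivial G]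
    (h : NF w k c l) {S : Type} (τ : Equiv.Perm S) (B : Set S) (s : S)
    (hs : ∀ f, ThetaS τ B w f s = f s) : c (patt τ B s) = 1 ∧ (τ ^ k) s = s := by
  classical
  have h1 : c (patt τ B s) = 1 := by
    have := h.2 S τ B (fun _ => 1) s
    rw [hs] at this
    simpa using this.symm
  refine ⟨h1, ?_⟩
  by_contra hne
  obtain ⟨a, ha⟩ := exists_ne (1 : G)
  have := h.2 S τ B (fun t => if t = s then a else 1) s
  rw [hs, h1] at this
  simp [hne] at this
  exact ha this

/-! #### The cyclic systems -/

theorem finRotate_zpow_val {n : ℕ} (hn : 0 < n) (s : Fin n) (k : ℤ) :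
    ((((finRotate n) ^ k) s : Fin n) : ℤ) = ((s : ℤ) + k) % n := by
  have key : ∀ s : Fin n, ((finRotate n s : Fin n) : ℤ) = ((s : ℤ) + 1) % n := by
    intro s
    obtain ⟨m, rfl⟩ : ∃ m, n = m + 1 := ⟨n - 1, by omega⟩
    rw [finRotate_apply, Fin.val_add]
    push_cast
    rcases Nat.eq_zero_or_pos m with rfl | hm
    · simp
    · simp
  induction k using Int.induction_on generalizing s with
  | zero => simp; rw [Int.emod_eq_of_lt] <;> omega
  | succ i ih =>
    rw [zpow_add, zpow_one, Equiv.Perm.mul_apply, ih, key, Int.emod_add_emod]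
    congr 1; ring
  | pred i ih =>
    have h2 := ih ((finRotate n)⁻¹ s)
    have h3 := key ((finRotate n)⁻¹ s)
    have h4 : finRotate n ((finRotate n)⁻¹ s) = s := Equiv.apply_symm_apply _ s
    rw [h4] at h3
    rw [sub_eq_add_neg, zpow_add, zpow_neg_one, Equiv.Perm.mul_apply, h2, h3, Int.emod_add_emod]
    congr 1; ring

theorem patt_fin {n : ℕ} (hn : 0 < n) (s : Fin n) :
    patt (finRotate n) {t : Fin n | (t : ℕ) = 0} s = {m : ℤ | (n : ℤ) ∣ m + s} := by
  ext m
  simp only [patt, Set.mem_ofPred_eq]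
  have := finRotate_zpow_val hn s m
  rw [Int.dvd_iff_emod_eq_zero, add_comm m, ← this]
  norm_cast

end Systems

/-! ### Conveyor belts on a set `C` of cells with step `T` -/

section Belts

open Classical in
/-- The conveyor belt permutation: a site `(i, ε)` moves in direction `ε`, turning at the ends. -/
noncomputable def tau (C : Set ℤ) (T : ℤ) : Equiv.Perm (ℤ × ℤˣ) where
  toFun s := if s.1 ∈ C then (if s.1 + s.2 * T ∈ C then (s.1 + s.2 * T, s.2) else (s.1, -s.2)) else s
  invFun s := if s.1 ∈ C then (if s.1 - s.2 * T ∈ C then (s.1 - s.2 * T, s.2) else (s.1, -s.2)) else s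
  left_inv s := by
    obtain ⟨i, e⟩ := s
    by_cases h : i ∈ C
    · by_cases h2 : i + e * T ∈ C
      · simp [h, h2]
      · simp [h, h2]
    · simp [h]
  right_inv s := by
    obtain ⟨i, e⟩ := s
    by_cases h : i ∈ C
    · by_cases h2 : i - e * T ∈ C
      · simp [h, h2]
      · have : i + -(e * T) ∉ C := by rwa [← sub_eq_add_neg]
        simp [h, h2, this]
    · simp [h]

/-- The marked sites: those about to turn. -/
def Bset (C : Set ℤ) (T : ℤ) : Set (ℤ × ℤˣ) := {s | s.1 ∈ C ∧ s.1 + s.2 * T ∉ C}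

theorem tau_step {C : Set ℤ} {T : ℤ} {i : ℤ} {e : ℤˣ} (h : i ∈ C) (h2 : i + e * T ∈ C) :
    tau C T (i, e) = (i + e * T, e) := by
  simp [tau, h, h2]

theorem tau_turn {C : Set ℤ} {T : ℤ} {i : ℤ} {e : ℤˣ} (h : i ∈ C) (h2 : i + e * T ∉ C) :
    tau C T (i, e) = (i, -e) := by
  simp [tau, h, h2]

theorem tau_fst_mem {C : Set ℤ} {T : ℤ} (s : ℤ × ℤˣ) : (tau C T s).1 ∈ C ↔ s.1 ∈ C := by
  obtain ⟨i, e⟩ := s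
  by_cases h : i ∈ C
  · by_cases h2 : i + e * T ∈ C
    · rw [tau_step h h2]; simp [h, h2]
    · rw [tau_turn h h2]
  · simp [tau, h]

theorem tau_zpow_fst_mem {C : Set ℤ} {T : ℤ} (s : ℤ × ℤˣ) (k : ℤ) :
    ((tau C T ^ k) s).1 ∈ C ↔ s.1 ∈ C := by
  induction k using Int.induction_on generalizing s with
  | zero => simp
  | succ i ih => rw [zpow_add, zpow_one, Equiv.Perm.mul_apply, ih, tau_fst_mem]
  | pred i ih =>
    rw [sub_eq_add_neg, zpow_add, zpow_neg_one, Equiv.Perm.mul_apply, ih,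
      ← tau_fst_mem (T := T) ((tau C T)⁻¹ s)]
    have : tau C T ((tau C T)⁻¹ s) = s := Equiv.apply_symm_apply _ s
    rw [this]

/-- Travelling after a turn. -/
theorem tau_travel {C : Set ℤ} {T : ℤ} {i : ℤ} {e : ℤˣ} (hb : (i, e) ∈ Bset C T) (t : ℕ)
    (h : ∀ u : ℕ, u ≤ t → i - u * (e * T) ∈ C) :
    (tau C T ^ (t + 1)) (i, e) = (i - t * (e * T), -e) := by
  induction t with
  | zero => simp [tau_turn hb.1 hb.2]
  | succ t ih =>
    rw [pow_succ', Equiv.Perm.mul_apply, ih (fun u hu => h u (by omega)),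
      tau_step (h t (by omega))]
    · ext
      · simp; ring
      · simp
    · have := h (t + 1) le_rfl
      convert this using 1
      simp; ring

/-- Travelling backwards before a turn. -/
theorem tau_travel_back {C : Set ℤ} {T : ℤ} {i : ℤ} {e : ℤˣ} (t : ℕ)
    (h : ∀ u : ℕ, u ≤ t → i - u * (e * T) ∈ C) :
    (tau C T ^ t) (i - t * (e * T), e) = (i, e) := by
  induction t with
  | zero => simp
  | succ t ih =>
    rw [pow_succ, Equiv.Perm.mul_apply, tau_step (h (t + 1) le_rfl)]
    · have : i - ((t + 1 : ℕ) : ℤ) * (e * T) + e * T = i - t * (e * T) := by push_cast; ring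
      rw [this]
      exact ih (fun u hu => h u (by omega))
    · have := h t (by omega)
      convert this using 1
      push_cast; ring

/-- End points of a belt of length exactly `n`. -/
def Bn (C : Set ℤ) (T : ℤ) (n : ℕ) : Set (ℤ × ℤˣ) :=
  {s | s ∈ Bset C T ∧ (∀ u : ℕ, u < n → s.1 - u * (s.2 * T) ∈ C) ∧ s.1 - n * (s.2 * T) ∉ C}

theorem Bn_next {C : Set ℤ} {T : ℤ} {n : ℕ} {i : ℤ} {e : ℤˣ} (h : (i, e) ∈ Bn C T n)
    (hn : 0 < n) :
    (tau C T ^ n) (i, e) = (i - (n - 1 : ℕ) * (e * T), -e) ∧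
      (i - (n - 1 : ℕ) * (e * T), -e) ∈ Bn C T n := by
  obtain ⟨hb, h1, h2⟩ := h
  obtain ⟨k, rfl⟩ : ∃ k, n = k + 1 := ⟨n - 1, by omega⟩
  simp only [Nat.add_sub_cancel]
  refine ⟨tau_travel hb k (fun u hu => h1 u (by omega)), ⟨h1 k (by omega), ?_⟩, ?_, ?_⟩
  · convert h2 using 2
    simp; ring
  · intro u hu
    have := h1 (k - u) (by omega)
    convert this using 1
    rw [Nat.cast_sub (by omega)]
    simp; ring
  · convert hb.2 using 2
    simp; ring

theorem Bn_period {C : Set ℤ} {T : ℤ} {n : ℕ} {s : ℤ × ℤˣ} (h : s ∈ Bn C T n)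
    (hn : 0 < n) : (tau C T ^ n) s ∈ Bn C T n ∧ (tau C T ^ n) ((tau C T ^ n) s) = s := by
  obtain ⟨i, e⟩ := s
  obtain ⟨h1, h2⟩ := Bn_next h hn
  obtain ⟨h3, h4⟩ := Bn_next h2 hn
  rw [h1]
  refine ⟨h2, ?_⟩
  rw [h3]
  ext
  · simp
  · simp

theorem Bn_zpow {C : Set ℤ} {T : ℤ} {n : ℕ} {s : ℤ × ℤˣ} (h : s ∈ Bn C T n)
    (hn : 0 < n) (q : ℤ) : (tau C T ^ (n * q : ℤ)) s ∈ Bn C T n := by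
  induction q using Int.induction_on generalizing s with
  | zero => simpa using h
  | succ i ih =>
    rw [mul_add, zpow_add, Equiv.Perm.mul_apply]
    apply ih
    simpa using (Bn_period h hn).1
  | pred i ih =>
    rw [mul_sub, sub_eq_add_neg, zpow_add, Equiv.Perm.mul_apply]
    apply ih
    have h2 := (Bn_period h hn).2
    have : (tau C T ^ (-((n : ℤ) * 1))) s = (tau C T ^ n) s := by
      rw [mul_one, zpow_neg, zpow_natCast, Equiv.Perm.inv_eq_iff_eq]
      exact h2.symm
    rw [this]
    exact (Bn_period h hn).1

theorem patt_Bn {C : Set ℤ} {T : ℤ} {n : ℕ} {s : ℤ × ℤˣ} (h : s ∈ Bn C T n)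
    (hn : 0 < n) : patt (tau C T) (Bset C T) s = {m : ℤ | (n : ℤ) ∣ m} := by
  ext m
  simp only [patt, Set.mem_ofPred_eq]
  constructor
  · intro hm
    by_contra hd
    have hr0 : 0 < m % n := by
      have := Int.emod_nonneg m (b := n) (by omega)
      rcases this.lt_or_eq with h | h
      · exact h
      · exact absurd (Int.dvd_of_emod_eq_zero h.symm) hd
    have hr1 : m % n < n := Int.emod_lt_of_pos m (by omega)
    obtain ⟨r, hr⟩ : ∃ r : ℕ, m % n = r + 1 := ⟨(m % n - 1).toNat, by omega⟩
    have hmm : m = (r + 1 : ℕ) + n * (m / n) := by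
      have := Int.emod_add_mul_ediv m n
      push_cast; omega
    rw [hmm, zpow_add, Equiv.Perm.mul_apply, zpow_natCast] at hm
    have hB := Bn_zpow h hn (m / n)
    generalize (tau C T ^ ((n : ℤ) * (m / n))) s = s' at hm hB
    obtain ⟨i, e⟩ := s'
    obtain ⟨hb, h1, h2⟩ := hB
    rw [tau_travel hb r (fun u hu => h1 u (by omega))] at hm
    apply hm.2
    have := h1 (r + 1) (by omega)
    convert this using 1
    simp; ring
  · rintro ⟨q, rfl⟩
    exact (Bn_zpow h hn q).1

theorem patt_inf {C : Set ℤ} {T : ℤ} {i : ℤ} {e : ℤˣ} (hb : (i, e) ∈ Bset C T)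
    (h : ∀ u : ℕ, i - u * (e * T) ∈ C) : patt (tau C T) (Bset C T) (i, e) = {0} := by
  ext m
  simp only [patt, Set.mem_ofPred_eq, Set.mem_singleton_iff]
  constructor
  · intro hm
    by_contra h0
    rcases lt_or_gt_of_ne h0 with h1 | h1
    · obtain ⟨t, rfl⟩ : ∃ t : ℕ, m = -((t + 1 : ℕ) : ℤ) := ⟨(-m - 1).toNat, by omega⟩
      have : (tau C T ^ (-((t + 1 : ℕ) : ℤ))) (i, e) = (i - (t + 1 : ℕ) * (e * T), e) := by
        rw [zpow_neg, zpow_natCast, Equiv.Perm.inv_eq_iff_eq]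
        exact (tau_travel_back (t + 1) (fun u _ => h u)).symm
      rw [this] at hm
      apply hm.2
      convert h t using 1
      push_cast; ring
    · obtain ⟨t, rfl⟩ : ∃ t : ℕ, m = ((t + 1 : ℕ) : ℤ) := ⟨(m - 1).toNat, by omega⟩
      rw [zpow_natCast, tau_travel hb t (fun u _ => h u)] at hm
      apply hm.2
      convert h (t + 1) using 1
      simp; ring
  · rintro rfl
    simpa using hb

theorem patt_B {C : Set ℤ} {T : ℤ} {s : ℤ × ℤˣ} (hb : s ∈ Bset C T) :
    patt (tau C T) (Bset C T) s = {0} ∨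
      ∃ n : ℕ, 0 < n ∧ patt (tau C T) (Bset C T) s = {m : ℤ | (n : ℤ) ∣ m} := by
  classical
  obtain ⟨i, e⟩ := s
  by_cases h : ∀ u : ℕ, i - u * (e * T) ∈ C
  · exact Or.inl (patt_inf hb h)
  · push Not at h
    right
    have h0 : 0 < Nat.find h := by
      rw [Nat.find_pos]
      simpa using hb.1
    refine ⟨Nat.find h, h0, patt_Bn ⟨hb, fun u hu => ?_, Nat.find_spec h⟩ h0⟩
    have := Nat.find_min h hu
    simpa using this

/-- Every finite window of a visit pattern is a window of a cyclic one. -/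
theorem patt_window (C : Set ℤ) (T : ℤ) (s : ℤ × ℤˣ) (l : ℕ) :
    ∃ n : ℕ, 0 < n ∧ ∃ j : ℤ, ∀ m : ℤ, |m| ≤ l →
      (m ∈ patt (tau C T) (Bset C T) s ↔ (n : ℤ) ∣ m + j) := by
  by_cases hex : ∃ m0 : ℤ, |m0| ≤ l ∧ m0 ∈ patt (tau C T) (Bset C T) s
  · obtain ⟨m0, hm0, hp⟩ := hex
    have hshift : ∀ m, m ∈ patt (tau C T) (Bset C T) s ↔
        m - m0 ∈ patt (tau C T) (Bset C T) ((tau C T ^ m0) s) := by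
      intro m; rw [patt_zpow]; simp
    have hp' : (tau C T ^ m0) s ∈ Bset C T := hp
    rcases patt_B hp' with h | ⟨n, hn, h⟩
    · refine ⟨2 * l + 1, by omega, -m0, fun m hm => ?_⟩
      rw [hshift, h]
      simp only [Set.mem_singleton_iff]
      constructor
      · intro h; rw [← sub_eq_add_neg, h]; simp
      · intro h
        rw [← sub_eq_add_neg] at h
        apply Int.eq_zero_of_abs_lt_dvd h
        have := abs_sub m m0
        push_cast; omega
    · refine ⟨n, hn, -m0, fun m hm => ?_⟩
      rw [hshift, h]
      simp [sub_eq_add_neg]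
  · push Not at hex
    refine ⟨2 * l + 2, by omega, l + 1, fun m hm => ?_⟩
    refine iff_of_false (hex m hm) ?_
    intro hd
    have := Int.le_of_dvd (by rw [abs_le] at hm; omega) hd
    rw [abs_le] at hm
    push_cast at this
    omega

end Belts

/-! ### Words, automata, and surgery in sofic shifts -/

section Words

variable {Γ : Type}

/-- The factor of `x` of length `n` starting at `i`. -/
def fac (x : ℤ → Γ) (i : ℤ) (n : ℕ) : List Γ := (List.range n).map fun t : ℕ => x (i + t)

@[simp] theorem fac_length (x : ℤ → Γ) (i : ℤ) (n : ℕ) : (fac x i n).length = n := by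
  simp [fac]

theorem fac_add (x : ℤ → Γ) (i : ℤ) (a b : ℕ) :
    fac x i (a + b) = fac x i a ++ fac x (i + a) b := by
  simp [fac, List.range_add, Function.comp_def, add_assoc]

theorem fac_congr {x y : ℤ → Γ} {i j : ℤ} {n : ℕ}
    (h : ∀ t : ℕ, t < n → x (i + t) = y (j + t)) : fac x i n = fac y j n := by
  unfold fac
  apply List.map_congr_left
  intro t ht
  exact h t (List.mem_range.1 ht)

theorem fac_split {x : ℤ → Γ} {i : ℤ} {n : ℕ} {u v : List Γ} (h : fac x i n = u ++ v) :
    u = fac x i u.length ∧ v = fac x (i + u.length) v.length := by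
  have hn : n = u.length + v.length := by
    have := congrArg List.length h
    simpa using this
  rw [hn, fac_add] at h
  have := List.append_inj h (by simp)
  exact ⟨this.1.symm, this.2.symm⟩

theorem fac_sub (x : ℤ → Γ) {a i : ℤ} {N n : ℕ} (h1 : a ≤ i) (h2 : i + n ≤ a + N) :
    ∃ u t, fac x a N = u ++ fac x i n ++ t := by
  obtain ⟨k, rfl⟩ : ∃ k : ℕ, i = a + k := ⟨(i - a).toNat, by omega⟩
  obtain ⟨r, rfl⟩ : ∃ r : ℕ, N = k + n + r := ⟨N - k - n, by omega⟩
  exact ⟨_, _, by rw [fac_add, fac_add]⟩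

/-- `w` contains a nonempty factor in `L`. -/
def badW (L : Language Γ) (w : List Γ) : Prop :=
  ∃ u v t, w = u ++ v ++ t ∧ v ≠ [] ∧ v ∈ L

/-- The automaton recognizing words with a nonempty factor in the language of `M`. -/
def badDFA {σ : Type} (M : DFA Γ σ) : DFA Γ (Set σ × Prop) where
  step s a := ({q | ∃ p, (p ∈ s.1 ∨ p = M.start) ∧ q = M.step p a},
    s.2 ∨ ∃ p, (p ∈ s.1 ∨ p = M.start) ∧ M.step p a ∈ M.accept)
  start := (∅, False)
  accept := {s | s.2}

theorem badDFA_eval {σ : Type} (M : DFA Γ σ) (w : List Γ) :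
    (∀ q, q ∈ ((badDFA M).eval w).1 ↔ ∃ u v, w = u ++ v ∧ v ≠ [] ∧ M.eval v = q) ∧
    (((badDFA M).eval w).2 ↔ badW M.accepts w) := by
  induction w using List.reverseRecOn with
  | nil =>
    constructor
    · intro q
      simp only [DFA.eval_nil]
      constructor
      · intro h; exact absurd h (by simp [badDFA])
      · rintro ⟨u, v, h, hv, _⟩
        have := (List.append_eq_nil_iff.1 h.symm).2
        exact absurd this hv
    · simp only [DFA.eval_nil]
      constructor
      · intro h; exact absurd h (by simp [badDFA])
      · rintro ⟨u, v, t, h, hv, _⟩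
        have := (List.append_eq_nil_iff.1 (List.append_eq_nil_iff.1 h.symm).1).2
        exact absurd this hv
  | append_singleton w a ih =>
    obtain ⟨ih1, ih2⟩ := ih
    have key : ∀ p, (p ∈ ((badDFA M).eval w).1 ∨ p = M.start) ↔
        ∃ u v, w = u ++ v ∧ M.eval v = p := by
      intro p
      rw [ih1]
      constructor
      · rintro (⟨u, v, h, _, h2⟩ | rfl)
        · exact ⟨u, v, h, h2⟩
        · exact ⟨w, [], by simp, by simp⟩
      · rintro ⟨u, v, h, h2⟩
        by_cases hv : v = []
        · right; subst hv; simpa using h2.symm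
        · left; exact ⟨u, v, h, hv, h2⟩
    constructor
    · intro q
      rw [DFA.eval_append_singleton]
      change (∃ p, (p ∈ ((badDFA M).eval w).1 ∨ p = M.start) ∧ q = M.step p a) ↔ _
      constructor
      · rintro ⟨p, hp, rfl⟩
        obtain ⟨u, v, h, h2⟩ := (key p).1 hp
        exact ⟨u, v ++ [a], by simp [h], by simp, by simp [h2]⟩
      · rintro ⟨u, v, h, hv, h2⟩
        obtain ⟨v', b, rfl⟩ : ∃ v' b, v = v' ++ [b] := by
          rcases List.eq_nil_or_concat v with h | ⟨v', b, h⟩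
          · exact absurd h hv
          · exact ⟨v', b, by simpa using h⟩
        rw [← List.append_assoc] at h
        have h3 := List.append_inj' h rfl
        have hb : a = b := by simpa using h3.2
        subst hb
        exact ⟨M.eval v', (key _).2 ⟨u, v', h3.1, rfl⟩, by simpa using h2.symm⟩
    · rw [DFA.eval_append_singleton]
      change (((badDFA M).eval w).2 ∨
        ∃ p, (p ∈ ((badDFA M).eval w).1 ∨ p = M.start) ∧ M.step p a ∈ M.accept) ↔ _
      rw [ih2]
      constructor
      · rintro (⟨u, v, t, h, hv, hL⟩ | ⟨p, hp, hacc⟩)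
        · exact ⟨u, v, t ++ [a], by simp [h], hv, hL⟩
        · obtain ⟨u, v, h, h2⟩ := (key p).1 hp
          refine ⟨u, v ++ [a], [], by simp [h], by simp, ?_⟩
          rw [DFA.mem_accepts]
          simpa [h2] using hacc
      · rintro ⟨u, v, t, h, hv, hL⟩
        rcases List.eq_nil_or_concat t with rfl | ⟨t', b, rfl⟩
        · right
          obtain ⟨v', b, rfl⟩ : ∃ v' b, v = v' ++ [b] := by
            rcases List.eq_nil_or_concat v with h | ⟨v', b, h⟩
            · exact absurd h hv
            · exact ⟨v', b, by simpa using h⟩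
          rw [List.append_nil, ← List.append_assoc] at h
          have h3 := List.append_inj' h rfl
          have hb : a = b := by simpa using h3.2
          subst hb
          refine ⟨M.eval v', (key _).2 ⟨u, v', h3.1, rfl⟩, ?_⟩
          rw [DFA.mem_accepts] at hL
          simpa using hL
        · left
          rw [List.concat_eq_append, ← List.append_assoc] at h
          have h3 := List.append_inj' h rfl
          exact ⟨u, v, t', h3.1, hv, hL⟩

/-- `M` presents `X` by bad factors. -/
structure Presents {Q : Type} (M : DFA Γ Q) (X : Set (ℤ → Γ)) : Prop where
  mem_iff : ∀ x, x ∈ X ↔ ∀ i n, M.eval (fac x i n) ∉ M.accept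
  mono : ∀ u v t, M.eval v ∈ M.accept → M.eval (u ++ v ++ t) ∈ M.accept

theorem exists_presents {X : Set (ℤ → Γ)} [TopologicalSpace Γ] (hX : IsSoficShift X) :
    ∃ (Q : Type) (_ : Finite Q) (M : DFA Γ Q), Presents M X := by
  obtain ⟨_, _, L, ⟨σ, hσ, M, rfl⟩, hXL⟩ := hX
  refine ⟨Set σ × Prop, inferInstance, badDFA M, ?_, ?_⟩
  · intro x
    have hb : ∀ w, (badDFA M).eval w ∈ (badDFA M).accept ↔ badW M.accepts w :=
      fun w => (badDFA_eval M w).2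
    simp only [hb]
    rw [hXL]
    constructor
    · rintro h i n ⟨u, v, t, huvt, hv, hL⟩
      have h1 := (fac_split (fac_split huvt).1.symm).2
      obtain ⟨k, hk⟩ : ∃ k, v.length = k + 1 :=
        ⟨v.length - 1, by have := List.length_pos_iff.2 hv; omega⟩
      rw [hk] at h1
      exact h _ k (h1 ▸ hL)
    · intro h i k hL
      exact h i (k + 1) ⟨[], _, [], by simp [fac], by
        rw [ne_eq, ← List.length_eq_zero_iff]; simp, hL⟩
  · intro u v t h
    have hb : ∀ w, (badDFA M).eval w ∈ (badDFA M).accept ↔ badW M.accepts w :=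
      fun w => (badDFA_eval M w).2
    rw [hb] at h ⊢
    obtain ⟨u', v', t', rfl, hv, hL⟩ := h
    exact ⟨u ++ u', v', t' ++ t, by simp, hv, hL⟩

/-- The transition function of a word. -/
def kap {Q : Type} (M : DFA Γ Q) (w : List Γ) : Q → Q := fun q => M.evalFrom q w

theorem kap_append {Q : Type} (M : DFA Γ Q) (u v : List Γ) :
    kap M (u ++ v) = kap M v ∘ kap M u := by
  funext q; simp [kap, DFA.evalFrom_of_append]

theorem eval_eq_kap {Q : Type} (M : DFA Γ Q) (u : List Γ) : M.eval u = kap M u M.start := rfl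

theorem surgery {Q : Type} {M : DFA Γ Q} {X : Set (ℤ → Γ)} (hM : Presents M X)
    {x y : ℤ → Γ} (hx : x ∈ X) (j : ℤ) (d d' : ℕ) (h1 : ∀ t, t < j → y t = x t)
    (h2 : ∀ t, j ≤ t → y (t + d') = x (t + d)) (h3 : kap M (fac y j d') = kap M (fac x j d)) :
    y ∈ X := by
  rw [hM.mem_iff]
  intro i n hacc
  obtain ⟨A, hA⟩ : ∃ A : ℕ, min i j = j - A := ⟨(j - min i j).toNat, by omega⟩
  obtain ⟨R, hR⟩ : ∃ R : ℕ, max (i + n) (j + d') = j + d' + R :=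
    ⟨(max (i + n) (j + d') - (j + d')).toNat, by omega⟩
  obtain ⟨u, t, hut⟩ := fac_sub y (a := j - A) (i := i) (N := A + d' + R) (n := n)
    (by omega) (by push_cast; omega)
  have hbad := hM.mono u _ t hacc
  rw [← hut, fac_add, fac_add] at hbad
  have hx' := (hM.mem_iff x).1 hx (j - A) (A + d + R)
  rw [fac_add, fac_add] at hx'
  apply hx'
  rw [eval_eq_kap, kap_append, kap_append] at hbad ⊢
  have e1 : j - A + A = j := by ring
  have e2 : j - A + ((A + d' : ℕ) : ℤ) = j + d' := by push_cast; ring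
  have e3 : j - A + ((A + d : ℕ) : ℤ) = j + d := by push_cast; ring
  rw [e1, e2, h3] at hbad
  rw [e1, e3]
  have f1 : fac y (j - A) A = fac x (j - A) A := fac_congr fun t ht => h1 _ (by omega)
  have f2 : fac y (j + d') R = fac x (j + d) R := fac_congr fun t ht => by
    have := h2 (j + t) (by omega)
    convert this using 2 <;> ring
  rw [f1, f2] at hbad
  exact hbad

/-- Replacing words in arbitrarily many disjoint areas. -/
theorem multi_surgery {Q : Type} {M : DFA Γ Q} {X : Set (ℤ → Γ)} (hM : Presents M X)
    {x y : ℤ → Γ} (hx : x ∈ X) (A : Set ℤ) (d : ℕ)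
    (hA : ∀ i ∈ A, ∀ j ∈ A, i < j → i + d ≤ j)
    (hoff : ∀ t, (∀ i ∈ A, ¬ (i ≤ t ∧ t < i + d)) → y t = x t)
    (hk : ∀ i ∈ A, kap M (fac y i d) = kap M (fac x i d)) : y ∈ X := by
  classical
  let z : Finset ℤ → ℤ → Γ := fun F t =>
    if ∃ i ∈ F, i ∈ A ∧ i ≤ t ∧ t < i + d then y t else x t
  have hz : ∀ F, z F ∈ X := by
    intro F
    induction F using Finset.induction_on with
    | empty =>
      have : z ∅ = x := by funext t; simp [z]
      rw [this]; exact hx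
    | insert j F hj ih =>
      by_cases hjA : j ∈ A
      · have hout : ∀ t, ¬ (j ≤ t ∧ t < j + d) → z (insert j F) t = z F t := by
          intro t ht
          simp only [z, Finset.mem_insert]
          congr 1
          apply propext
          constructor
          · rintro ⟨i, rfl | hi, h⟩
            · exact absurd h.2 ht
            · exact ⟨i, hi, h⟩
          · rintro ⟨i, hi, h⟩
            exact ⟨i, Or.inr hi, h⟩
        refine surgery hM ih j d d (fun t ht => hout t (by omega))
          (fun t ht => hout _ (by omega)) ?_
        have f1 : fac (z (insert j F)) j d = fac y j d := fac_congr fun t ht => by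
          simp only [z]
          rw [if_pos ⟨j, by simp, hjA, by omega, by omega⟩]
        have f2 : fac (z F) j d = fac x j d := fac_congr fun t ht => by
          simp only [z]
          rw [if_neg]
          rintro ⟨i, hi, hiA, h1, h2⟩
          rcases lt_trichotomy i j with h | h | h
          · have := hA i hiA j hjA h; omega
          · subst h; exact hj hi
          · have := hA j hjA i hiA h; omega
        rw [f1, f2, hk j hjA]
      · have : z (insert j F) = z F := by
          funext t
          simp only [z, Finset.mem_insert]
          congr 1
          apply propext
          constructor
          · rintro ⟨i, rfl | hi, h⟩
            · exact absurd h.1 hjA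
            · exact ⟨i, hi, h⟩
          · rintro ⟨i, hi, h⟩
            exact ⟨i, Or.inr hi, h⟩
        rw [this]; exact ih
  rw [hM.mem_iff]
  intro i n
  have hzz := (hM.mem_iff _).1 (hz (Finset.Icc (i - d) (i + n))) i n
  have : fac y i n = fac (z (Finset.Icc (i - d) (i + n))) i n := fac_congr fun t ht => by
    simp only [z]
    split_ifs with h
    · rfl
    · apply hoff
      rintro j hj ⟨h1, h2⟩
      exact h ⟨j, by rw [Finset.mem_Icc]; omega, hj, h1, h2⟩
  rw [this]; exact hzz

end Words

/-! ### Two distinct idempotent words from uncountability -/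

section Idem

variable {Γ : Type}

/-- Factor of a one-sided sequence. -/
def nfac (y : ℕ → Γ) (i n : ℕ) : List Γ := (List.range n).map fun t : ℕ => y (i + t)

/-- A Ramsey type argument for one-sided sequences. -/
theorem ramsey_tail {K : Type} [Finite K] (y : ℕ → Γ) (c : ℕ → ℕ → K)
    (hy : ¬ ∃ N p : ℕ, 0 < p ∧ ∀ t, N ≤ t → y (t + p) = y t) :
    ∃ i a b : ℕ, c i (i + a) = c (i + a) (i + a + b) ∧ c i (i + a + b) = c i (i + a) ∧
      nfac y i a ++ nfac y (i + a) b ≠ nfac y (i + a) b ++ nfac y i a := by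
  classical
  let U : Ultrafilter ℕ := Filter.hyperfilter ℕ
  have hlim : ∀ f : ℕ → K, ∃ k, ∀ᶠ n in (U : Filter ℕ), f n = k := by
    intro f
    have := (Ultrafilter.eventually_exists_iff (f := U) (P := fun k n => f n = k)).1
      (Filter.Eventually.of_forall fun n => ⟨f n, rfl⟩)
    exact this
  choose d hd using fun i => hlim (c i)
  obtain ⟨e, he⟩ := hlim d
  have hgt : ∀ m : ℕ, ∀ᶠ n in (U : Filter ℕ), m < n := by
    intro m
    have h1 : (U : Filter ℕ) ≤ Filter.cofinite := Filter.hyperfilter_le_cofinite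
    rw [Nat.cofinite_eq_atTop] at h1
    exact h1 (Filter.eventually_gt_atTop m)
  obtain ⟨i, hi⟩ := he.exists
  obtain ⟨j, ⟨hj1, hj2⟩, hj3⟩ := ((he.and (hd i)).and (hgt i)).exists
  by_contra hcon
  push Not at hcon
  apply hy
  refine ⟨i, j - i, by omega, fun t ht => ?_⟩
  obtain ⟨k, ⟨hk1, hk2⟩, hk3⟩ := (((hd i).and (hd j)).and (hgt (j + t))).exists
  have hcomm := hcon i (j - i) (k - j) (by
    rw [show i + (j - i) = j by omega, show j + (k - j) = k by omega, hj2, hk2, hi, hj1]) (by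
    rw [show i + (j - i) = j by omega, show j + (k - j) = k by omega, hj2, hk1])
  have happ : nfac y i (j - i) ++ nfac y (i + (j - i)) (k - j) = nfac y i ((j - i) + (k - j)) := by
    simp [nfac, List.range_add, Function.comp_def, add_assoc]
  rw [happ] at hcomm
  have := congrArg (fun l => l[t - i]?) hcomm
  rw [List.getElem?_append_left (by simp [nfac]; omega)] at this
  simp only [nfac, List.getElem?_map] at this
  rw [List.getElem?_range (by omega), List.getElem?_range (by omega)] at this
  simp only [Option.map_some, Option.some.injEq] at this
  rw [show i + (t - i) = t by omega, show i + (j - i) + (t - i) = t + (j - i) by omega] at this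
  exact this.symm

theorem countable_periodic [Finite Γ] (X : Set (ℤ → Γ))
    (h1 : ∀ x ∈ X, ∃ N p : ℕ, 0 < p ∧ ∀ t : ℕ, N ≤ t → x ((t + p : ℕ) : ℤ) = x (t : ℤ))
    (h2 : ∀ x ∈ X, ∃ N p : ℕ, 0 < p ∧ ∀ t : ℕ, N ≤ t → x (-((t + p : ℕ) : ℤ)) = x (-(t : ℤ))) :
    X.Countable := by
  let E : (ℕ × ℕ) × (ℕ × ℕ) → Set (ℤ → Γ) := fun z => {x |
    (0 < z.1.2 ∧ ∀ t : ℕ, z.1.1 ≤ t → x ((t + z.1.2 : ℕ) : ℤ) = x (t : ℤ)) ∧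
    (0 < z.2.2 ∧ ∀ t : ℕ, z.2.1 ≤ t → x (-((t + z.2.2 : ℕ) : ℤ)) = x (-(t : ℤ)))}
  have hsub : X ⊆ ⋃ z, E z := by
    intro x hx
    obtain ⟨N, p, h⟩ := h1 x hx
    obtain ⟨N', p', h'⟩ := h2 x hx
    exact Set.mem_iUnion.2 ⟨((N, p), (N', p')), h, h'⟩
  refine Set.Countable.mono hsub (Set.countable_iUnion ?_)
  rintro ⟨⟨N, p⟩, ⟨N', p'⟩⟩
  let f : (ℤ → Γ) → (Finset.Icc (-((N' + p' : ℕ) : ℤ)) ((N + p : ℕ) : ℤ) → Γ) := fun x t => x t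
  refine Set.countable_of_injective_of_countable_image (f := f) ?_ (Set.toFinite _).countable
  rintro x ⟨⟨hp, hx⟩, ⟨hp', hx'⟩⟩ y ⟨⟨_, hy⟩, ⟨_, hy'⟩⟩ hxy
  have hw : ∀ t : ℤ, -((N' + p' : ℕ) : ℤ) ≤ t → t ≤ ((N + p : ℕ) : ℤ) → x t = y t := by
    intro t ht1 ht2
    exact congrFun hxy ⟨t, Finset.mem_Icc.2 ⟨ht1, ht2⟩⟩
  have hpos : ∀ t : ℕ, x (t : ℤ) = y (t : ℤ) := by
    intro t
    induction t using Nat.strong_induction_on with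
    | _ t ih =>
      by_cases ht : t ≤ N + p
      · exact hw _ (by omega) (by omega)
      · have e1 := hx (t - p) (by simp only; omega)
        have e2 := hy (t - p) (by simp only; omega)
        simp only at e1 e2
        rw [show t - p + p = t by omega] at e1 e2
        rw [e1, e2]
        exact ih _ (by simp only at hp; omega)
  have hneg : ∀ t : ℕ, x (-(t : ℤ)) = y (-(t : ℤ)) := by
    intro t
    induction t using Nat.strong_induction_on with
    | _ t ih =>
      by_cases ht : t ≤ N' + p'
      · exact hw _ (by omega) (by omega)
      · have e1 := hx' (t - p') (by simp only; omega)
        have e2 := hy' (t - p') (by simp only; omega)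
        simp only at e1 e2
        rw [show t - p' + p' = t by omega] at e1 e2
        rw [e1, e2]
        exact ih _ (by simp only at hp'; omega)
  funext t
  rcases le_total 0 t with h | h
  · obtain ⟨n, rfl⟩ := Int.eq_ofNat_of_zero_le h
    exact hpos n
  · obtain ⟨n, hn⟩ := Int.eq_ofNat_of_zero_le (by omega : 0 ≤ -t)
    rw [show t = -(n : ℤ) by omega]
    exact hneg n

theorem idem_words {Q : Type} [Finite Q] (M : DFA Γ Q) (x : ℤ → Γ) (i : ℤ) (a b : ℕ)
    (h1 : kap M (fac x i a) = kap M (fac x (i + a) b))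
    (h2 : kap M (fac x i (a + b)) = kap M (fac x i a))
    (hne : fac x i a ++ fac x (i + a) b ≠ fac x (i + a) b ++ fac x i a) :
    ∃ (i : ℤ) (n : ℕ) (p q : List Γ) (e : Q → Q), e ∘ e = e ∧ kap M (fac x i n) = e ∧
      kap M p = e ∧ kap M q = e ∧ p.length = q.length ∧ p ≠ q := by
  refine ⟨i, a, fac x i a ++ fac x (i + a) b, fac x (i + a) b ++ fac x i a,
    kap M (fac x i a), ?_, rfl, ?_, ?_, by simp [add_comm], hne⟩
  · have := h2
    rw [fac_add, kap_append, ← h1] at this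
    exact this
  · rw [← fac_add, h2]
  · have := h2
    rw [fac_add, kap_append, ← h1] at this
    rw [kap_append, ← h1, this]

theorem exists_idem_words {Q : Type} [Finite Q] [Finite Γ] (M : DFA Γ Q) (X : Set (ℤ → Γ))
    (hunc : ¬ X.Countable) :
    ∃ x ∈ X, ∃ (i : ℤ) (n : ℕ) (p q : List Γ) (e : Q → Q), e ∘ e = e ∧ kap M (fac x i n) = e ∧
      kap M p = e ∧ kap M q = e ∧ p.length = q.length ∧ p ≠ q := by
  by_contra hcon
  apply hunc
  apply countable_periodic
  · intro x hx
    by_contra hper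
    apply hcon
    obtain ⟨i, a, b, h1, h2, h3⟩ := ramsey_tail (fun n : ℕ => x (n : ℤ))
      (fun i j => kap M (fac x i (j - i))) hper
    have hf : ∀ i n : ℕ, nfac (fun n : ℕ => x (n : ℤ)) i n = fac x i n := by
      intro i n; simp [nfac, fac]
    rw [hf, hf] at h3
    simp only [add_assoc, Nat.add_sub_cancel_left] at h1 h2
    rw [show i + (a + b) - (i + a) = b by omega] at h1
    exact ⟨x, hx, idem_words M x i a b (by simpa using h1) h2 (by simpa using h3)⟩
  · intro x hx
    by_contra hper
    apply hcon
    obtain ⟨i, a, b, h1, h2, h3⟩ := ramsey_tail (fun n : ℕ => x (-(n : ℤ)))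
      (fun i j => kap M (fac x (1 - j) (j - i))) hper
    have hf : ∀ i n : ℕ, nfac (fun n : ℕ => x (-(n : ℤ))) i n =
        (fac x (1 - ((i + n : ℕ) : ℤ)) n).reverse := by
      intro i n
      apply List.ext_getElem
      · simp [nfac]
      · intro t ht1 ht2
        simp [nfac] at ht1
        simp [nfac, fac]
        congr 1
        omega
    rw [hf, hf, ← List.reverse_append, ← List.reverse_append] at h3
    have h3' : fac x (1 - ((i + a + b : ℕ) : ℤ)) b ++ fac x (1 - ((i + a : ℕ) : ℤ)) a ≠
        fac x (1 - ((i + a : ℕ) : ℤ)) a ++ fac x (1 - ((i + a + b : ℕ) : ℤ)) b := by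
      intro h; apply h3; rw [h]
    rw [show i + a - i = a by omega, show i + a + b - (i + a) = b by omega] at h1
    rw [show i + a - i = a by omega, show i + a + b - i = b + a by omega] at h2
    have e1 : (1 - ((i + a : ℕ) : ℤ)) = (1 - ((i + a + b : ℕ) : ℤ)) + b := by push_cast; ring
    rw [e1] at h1 h2 h3'
    exact ⟨x, hx, idem_words M x _ b a h1.symm (by rw [h2, h1]) h3'⟩

end Idem

/-! ### Marker words -/

section Marker

variable {Γ : Type}

/-- The word `W` occurs in `w` at position `i`. -/
def Mt (w : ℤ → Γ) (i : ℤ) (W : List Γ) : Prop :=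
  ∀ t : ℕ, t < W.length → W[t]? = some (w (i + t))

theorem Mt_append {w : ℤ → Γ} {i : ℤ} {u v : List Γ} :
    Mt w i (u ++ v) ↔ Mt w i u ∧ Mt w (i + u.length) v := by
  constructor
  · intro h
    constructor
    · intro t ht
      have := h t (by simp; omega)
      rwa [List.getElem?_append_left ht] at this
    · intro t ht
      have := h (u.length + t) (by simp; omega)
      rw [List.getElem?_append_right (by omega)] at this
      rw [show u.length + t - u.length = t by omega] at this
      rw [this]; push_cast; rw [add_assoc]
  · rintro ⟨h1, h2⟩ t ht
    by_cases h : t < u.length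
    · rw [List.getElem?_append_left h]; exact h1 t h
    · rw [List.getElem?_append_right (by omega), h2 (t - u.length) (by simp at ht; omega)]
      congr 2
      omega

theorem Mt_fac {w : ℤ → Γ} {i : ℤ} {W : List Γ} (h : Mt w i W) : fac w i W.length = W := by
  apply List.ext_getElem?
  intro t
  by_cases ht : t < W.length
  · rw [h t ht]; simp [fac, ht]
  · rw [List.getElem?_eq_none (by simp; omega), List.getElem?_eq_none (by omega)]

theorem Mt_unique {w : ℤ → Γ} {i : ℤ} {W W' : List Γ} (h : Mt w i W) (h' : Mt w i W')
    (hl : W.length = W'.length) : W = W' := by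
  rw [← Mt_fac h, ← Mt_fac h', hl]

theorem Mt_congr {w w' : ℤ → Γ} {i : ℤ} {W : List Γ}
    (hw : ∀ t : ℕ, t < W.length → w (i + t) = w' (i + t)) (h : Mt w i W) : Mt w' i W := by
  intro t ht
  rw [h t ht, hw t ht]

/-- Power of a word. -/
def pw (p : List Γ) : ℕ → List Γ
  | 0 => []
  | n + 1 => p ++ pw p n

theorem pw_length (p : List Γ) (n : ℕ) : (pw p n).length = n * p.length := by
  induction n with
  | zero => simp [pw]
  | succ n ih => simp [pw, ih]; ring

theorem pw_add (p : List Γ) (a b : ℕ) : pw p (a + b) = pw p a ++ pw p b := by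
  induction a with
  | zero => simp [pw]
  | succ a ih => rw [show a + 1 + b = (a + b) + 1 by ring]; simp [pw, ih]

theorem Mt_pw {w : ℤ → Γ} {i : ℤ} {p : List Γ} {N : ℕ} (h : Mt w i (pw p N)) {r : ℕ}
    (hr : r < N) : Mt w (i + r * p.length) p := by
  obtain ⟨b, rfl⟩ : ∃ b, N = r + (b + 1) := ⟨N - r - 1, by omega⟩
  rw [pw_add] at h
  have h2 := (Mt_append.1 h).2
  have h3 := (Mt_append.1 (show Mt w _ (p ++ pw p b) from h2)).1
  rw [pw_length] at h3
  push_cast at h3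
  exact h3

theorem Mt_pw_period {w : ℤ → Γ} {i : ℤ} {p : List Γ} {N : ℕ} (h : Mt w i (pw p N)) {u : ℕ}
    (hu : u + p.length < N * p.length) : w (i + ((u + p.length : ℕ) : ℤ)) = w (i + u) := by
  have hP : 0 < p.length := by
    rcases Nat.eq_zero_or_pos p.length with h0 | h0
    · rw [h0] at hu; omega
    · exact h0
  have hdm := Nat.div_add_mod u p.length
  have hlt := Nat.mod_lt u hP
  have hr : u / p.length + 1 < N := by
    by_contra hcon
    have : N * p.length ≤ (u / p.length + 1) * p.length := Nat.mul_le_mul_right _ (by omega)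
    have e : (u / p.length + 1) * p.length = p.length * (u / p.length) + p.length := by ring
    omega
  have h1 := Mt_pw h (r := u / p.length) (by omega) (u % p.length) hlt
  have h2 := Mt_pw h (r := u / p.length + 1) hr (u % p.length) hlt
  rw [h1] at h2
  have h3 := Option.some.inj h2
  have e : (u : ℤ) = p.length * ((u / p.length : ℕ) : ℤ) + ((u % p.length : ℕ) : ℤ) := by
    exact_mod_cast hdm.symm
  have e1 : i + ((u + p.length : ℕ) : ℤ) =
      i + ((u / p.length + 1 : ℕ) : ℤ) * p.length + ((u % p.length : ℕ) : ℤ) := by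
    push_cast at e ⊢; linarith
  have e2 : i + (u : ℤ) =
      i + ((u / p.length : ℕ) : ℤ) * p.length + ((u % p.length : ℕ) : ℤ) := by
    linarith
  rw [e1, e2, h3]

theorem no_overlap {w : ℤ → Γ} {i : ℤ} {p q : List Γ} {N s : ℕ} (hlen : p.length = q.length)
    (hne : p ≠ q) (h1 : Mt w i (pw p (N + 1) ++ q)) (h2 : Mt w (i + s) (pw p (N + 1) ++ q))
    (hs0 : 0 < s) (hs : s ≤ N * p.length) : False := by
  apply hne
  obtain ⟨ha1, hb1⟩ := Mt_append.1 h1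
  obtain ⟨ha2, hb2⟩ := Mt_append.1 h2
  rw [pw_length] at hb1 hb2
  have hshift : ∀ u : ℕ, u < (N + 1) * p.length + p.length → w (i + s + u) = w (i + u) := by
    intro u hu
    have hl : u < (pw p (N + 1) ++ q).length := by
      rw [List.length_append, pw_length, ← hlen]; exact hu
    have e1 := h1 u hl
    have e2 := h2 u hl
    rw [e1] at e2
    exact (Option.some.inj e2).symm
  have hNP : (N + 1) * p.length = N * p.length + p.length := by ring
  have key : ∀ t : ℕ, t < p.length → q[t]? = p[t]? := by
    intro t
    induction t using Nat.strong_induction_on with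
    | _ t ih =>
      intro ht
      have hq := hb1 t (by omega)
      by_cases hts : t < s
      · have hper := Mt_pw_period ha2 (u := N * p.length + t - s) (by omega)
        have hp := Mt_pw ha1 (r := N) (by omega) t ht
        rw [hq, hp]
        congr 1
        have c1 : i + ((((N + 1) * p.length : ℕ)) : ℤ) + t =
            i + s + ((N * p.length + t - s + p.length : ℕ) : ℤ) := by
          rw [Nat.cast_add (N * p.length + t - s), Nat.cast_sub (by omega)]; push_cast; ring
        have c2 : i + s + ((N * p.length + t - s : ℕ) : ℤ) = i + N * p.length + t := by
          rw [Nat.cast_sub (by omega)]; push_cast; ring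
        rw [c1, hper, c2]
      · have hq' := hb1 (t - s) (by omega)
        have ih' := ih (t - s) (by omega) (by omega)
        have hp := Mt_pw ha1 (r := 0) (by omega) t ht
        have hp' := Mt_pw ha1 (r := 0) (by omega) (t - s) (by omega)
        have g1 := hshift ((N + 1) * p.length + (t - s)) (by omega)
        have g2 := hshift (t - s) (by omega)
        rw [hq', hp'] at ih'
        have ih'' := Option.some.inj ih'
        rw [hq, hp]
        congr 1
        have c1 : i + ((((N + 1) * p.length : ℕ)) : ℤ) + t =
            i + s + (((N + 1) * p.length + (t - s) : ℕ) : ℤ) := by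
          rw [Nat.cast_add, Nat.cast_sub (by omega)]; ring
        have c2 : i + (((N + 1) * p.length + (t - s) : ℕ) : ℤ) =
            i + ((((N + 1) * p.length : ℕ)) : ℤ) + ((t - s : ℕ) : ℤ) := by push_cast; ring
        have c3 : i + ((0 : ℕ) : ℤ) * p.length + t = i + s + ((t - s : ℕ) : ℤ) := by
          rw [Nat.cast_sub (by omega)]; push_cast; ring
        have c4 : i + ((0 : ℕ) : ℤ) * p.length + ((t - s : ℕ) : ℤ) = i + ((t - s : ℕ) : ℤ) := by
          push_cast; ring
        rw [c1, g1, c2, c3, g2, ih'', c4]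
  apply List.ext_getElem?
  intro t
  by_cases ht : t < p.length
  · exact (key t ht).symm
  · rw [List.getElem?_eq_none (by omega), List.getElem?_eq_none (by omega)]

/-- A marker together with data words. -/
structure Code (Γ L : Type) where
  m : List Γ
  d : ℕ
  enc : Option L → List Γ
  enc_len : ∀ k, (enc k).length = d
  enc_inj : Function.Injective enc
  gap : ∀ (w : ℤ → Γ) (i j : ℤ), Mt w i m → Mt w j m → i < j → (m.length + d : ℤ) < 2 * (j - i)

theorem kap_pw {Q : Type} {M : DFA Γ Q} {p u : List Γ} {e : Q → Q} (he : e ∘ e = e)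
    (hp : kap M p = e) (hu : kap M u = e) (n : ℕ) :
    kap M (pw p n ++ u) = e ∧ kap M (u ++ pw p n) = e := by
  constructor
  · induction n with
    | zero => simpa [pw] using hu
    | succ n ih => rw [pw, List.append_assoc, kap_append, ih, hp, he]
  · induction n generalizing u with
    | zero => simpa [pw] using hu
    | succ n ih => rw [pw, ← List.append_assoc]; exact ih (by rw [kap_append, hp, hu, he])

theorem exists_code {Q : Type} {M : DFA Γ Q} {p q : List Γ} {e : Q → Q} (he : e ∘ e = e)
    (hp : kap M p = e) (hq : kap M q = e) (hlen : p.length = q.length) (hne : p ≠ q)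
    (L : Type) [Finite L] :
    ∃ D : Code Γ L, kap M D.m = e ∧ ∀ k, kap M (D.enc k) = e := by
  obtain ⟨n, ⟨f⟩⟩ := Finite.exists_equiv_fin (Option L)
  let E : Option L → List Γ := fun k => pw p (f k : ℕ) ++ q ++ pw p (n - 1 - (f k : ℕ))
  have hinj : ∀ k k', (f k : ℕ) < f k' → E k ≠ E k' := by
    intro k k' hlt h
    simp only [E] at h
    obtain ⟨b, hb⟩ : ∃ b, (f k' : ℕ) = f k + (b + 1) := ⟨f k' - f k - 1, by omega⟩
    rw [hb, pw_add] at h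
    simp only [List.append_assoc, pw] at h
    have h2 := List.append_cancel_left h
    exact hne (List.append_inj h2 hlen.symm).1.symm
  refine ⟨⟨pw p (n + 2 + 1) ++ q, n * p.length, E, ?_, ?_, ?_⟩, ?_, ?_⟩
  · intro k
    simp only [E, List.length_append, pw_length, ← hlen]
    have := (f k).2
    obtain ⟨b, hb⟩ : ∃ b, n = f k + 1 + b := ⟨n - 1 - f k, by omega⟩
    have : n - 1 - (f k : ℕ) = b := by omega
    rw [this]
    conv_rhs => rw [hb]
    ring
  · intro k k' h
    rcases lt_trichotomy (f k : ℕ) (f k') with h' | h' | h'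
    · exact absurd h (hinj _ _ h')
    · exact f.injective (Fin.ext h')
    · exact absurd h.symm (hinj _ _ h')
  · intro w i j h1 h2 hij
    obtain ⟨s, rfl⟩ : ∃ s : ℕ, j = i + s := ⟨(j - i).toNat, by omega⟩
    by_contra hcon
    refine no_overlap hlen hne h1 h2 (by omega) ?_
    rw [List.length_append, pw_length, ← hlen] at hcon
    have e1 : (n + 2 + 1) * p.length = n * p.length + 3 * p.length := by ring
    have e2 : (n + 2) * p.length = n * p.length + 2 * p.length := by ring
    rw [e1] at hcon
    rw [e2]
    push_cast at hcon
    zify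
    linarith
  · exact (kap_pw he hp hq _).1
  · intro k
    exact (kap_pw he hp (kap_pw he hp hq _).1 _).2

end Marker

/-! ### Cells, labels and replacement -/

section Repl

variable {Γ L : Type} (D : Code Γ L)

/-- Distance between consecutive markers. -/
def Code.T : ℤ := D.m.length + D.d

/-- The cells of `x`. -/
def Code.cells (x : ℤ → Γ) : Set ℤ :=
  {i | Mt x i D.m ∧ Mt x (i + D.T) D.m ∧ ∃ l, Mt x (i + D.m.length) (D.enc (some l))}

/-- The position `t` lies in the data area of cell `i`. -/
def Code.area (i t : ℤ) : Prop := i + D.m.length ≤ t ∧ t < i + D.T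

open Classical in
/-- The label of a cell. -/
noncomputable def Code.lab [Inhabited L] (x : ℤ → Γ) (i : ℤ) : L :=
  if h : ∃ l, Mt x (i + D.m.length) (D.enc (some l)) then h.choose else default

open Classical in
/-- Replace the labels of all cells. -/
noncomputable def Code.repl (x : ℤ → Γ) (l : ℤ → L) : ℤ → Γ := fun t =>
  if h : ∃ i, i ∈ D.cells x ∧ D.area i t then
    ((D.enc (some (l h.choose)))[(t - h.choose - D.m.length).toNat]?).getD (x t)
  else x t

variable {D}

theorem Code.lab_eq [Inhabited L] {x : ℤ → Γ} {i : ℤ} {l : L}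
    (h : Mt x (i + D.m.length) (D.enc (some l))) : D.lab x i = l := by
  have hex : ∃ l, Mt x (i + D.m.length) (D.enc (some l)) := ⟨l, h⟩
  rw [Code.lab, dif_pos hex]
  have := D.enc_inj (Mt_unique hex.choose_spec h (by rw [D.enc_len, D.enc_len]))
  exact Option.some.inj this

theorem Code.lab_spec [Inhabited L] {x : ℤ → Γ} {i : ℤ} (h : i ∈ D.cells x) :
    Mt x (i + D.m.length) (D.enc (some (D.lab x i))) := by
  obtain ⟨l, hl⟩ := h.2.2
  rw [D.lab_eq hl]; exact hl

theorem Code.sep {x : ℤ → Γ} {i j : ℤ} (h1 : Mt x i D.m) (h2 : Mt x (i + D.T) D.m)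
    (hj : Mt x j D.m) (hij : i < j) : i + D.T ≤ j := by
  by_contra hcon
  have g1 := D.gap x i j h1 hj hij
  have g2 := D.gap x j (i + D.T) hj h2 (by omega)
  unfold Code.T at *
  omega

theorem Code.area_unique {x : ℤ → Γ} {i j t : ℤ} (hi : i ∈ D.cells x) (hj : j ∈ D.cells x)
    (h1 : D.area i t) (h2 : D.area j t) : i = j := by
  rcases lt_trichotomy i j with h | h | h
  · have := D.sep hi.1 hi.2.1 hj.1 h
    unfold Code.area at *; omega
  · exact h
  · have := D.sep hj.1 hj.2.1 hi.1 h
    unfold Code.area at *; omega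

theorem Code.repl_off {x : ℤ → Γ} {l : ℤ → L} {t : ℤ} (h : ∀ i ∈ D.cells x, ¬ D.area i t) :
    D.repl x l t = x t := by
  rw [Code.repl, dif_neg]
  rintro ⟨i, hi, ht⟩
  exact h i hi ht

theorem Code.repl_Mt {x : ℤ → Γ} {l : ℤ → L} {i : ℤ} (hi : i ∈ D.cells x) :
    Mt (D.repl x l) (i + D.m.length) (D.enc (some (l i))) := by
  intro t ht
  have hlen := D.enc_len (some (l i))
  have ha : D.area i (i + D.m.length + t) := by
    unfold Code.area Code.T; omega
  have hex : ∃ j, j ∈ D.cells x ∧ D.area j (i + D.m.length + t) := ⟨i, hi, ha⟩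
  have hch : hex.choose = i :=
    D.area_unique hex.choose_spec.1 hi hex.choose_spec.2 ha
  rw [Code.repl, dif_pos hex, hch]
  rw [show (i + (D.m.length : ℤ) + t - i - D.m.length).toNat = t by omega]
  rw [List.getElem?_eq_getElem ht]
  simp

theorem Code.area_index {i t : ℤ} (h : D.area i t) : ∃ u : ℕ, u < D.d ∧ t = i + D.m.length + u :=
  ⟨(t - i - D.m.length).toNat, by unfold Code.area Code.T at h; omega,
    by unfold Code.area Code.T at h; omega⟩

theorem Code.repl_unique {x y : ℤ → Γ} {l : ℤ → L}
    (h1 : ∀ t, (∀ i ∈ D.cells x, ¬ D.area i t) → y t = x t)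
    (h2 : ∀ i ∈ D.cells x, Mt y (i + D.m.length) (D.enc (some (l i)))) : y = D.repl x l := by
  funext t
  by_cases h : ∃ i ∈ D.cells x, D.area i t
  · obtain ⟨i, hi, ha⟩ := h
    obtain ⟨u, hu, rfl⟩ := Code.area_index ha
    have e1 := h2 i hi u (by rw [D.enc_len]; exact hu)
    have e2 := D.repl_Mt (l := l) hi u (by rw [D.enc_len]; exact hu)
    rw [e1] at e2
    exact Option.some.inj e2
  · push Not at h
    rw [h1 t h, Code.repl_off h]

theorem Code.cells_sub {x y : ℤ → Γ} {A : Set ℤ} (hA : A ⊆ D.cells x)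
    (h1 : ∀ t, (∀ i ∈ A, ¬ D.area i t) → y t = x t)
    (h2 : ∀ i ∈ A, ∃ l, Mt y (i + D.m.length) (D.enc (some l))) : D.cells x ⊆ D.cells y := by
  have hm : ∀ i, Mt x i D.m → Mt y i D.m := by
    intro i hi
    refine Mt_congr (fun t ht => (h1 _ ?_).symm) hi
    intro j hj ha
    have := D.sep (hA hj).1 (hA hj).2.1 hi (by unfold Code.area at ha; omega)
    unfold Code.area at ha; omega
  intro i hi
  refine ⟨hm _ hi.1, hm _ hi.2.1, ?_⟩
  by_cases hiA : i ∈ A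
  · exact h2 i hiA
  · obtain ⟨l, hl⟩ := hi.2.2
    refine ⟨l, Mt_congr (fun t ht => (h1 _ ?_).symm) hl⟩
    intro j hj ha
    rw [D.enc_len] at ht
    have : i = j := D.area_unique hi (hA hj) (by unfold Code.area Code.T; omega) ha
    exact hiA (this ▸ hj)

theorem Code.cells_repl {x : ℤ → Γ} {l : ℤ → L} : D.cells (D.repl x l) = D.cells x := by
  have h : D.cells x ⊆ D.cells (D.repl x l) :=
    Code.cells_sub le_rfl (fun t ht => Code.repl_off ht) (fun i hi => ⟨_, D.repl_Mt hi⟩)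
  refine Set.Subset.antisymm ?_ h
  exact Code.cells_sub h (fun t ht => (Code.repl_off ht).symm) (fun i hi => hi.2.2)

theorem Code.lab_repl [Inhabited L] {x : ℤ → Γ} {l : ℤ → L} {i : ℤ} (hi : i ∈ D.cells x) :
    D.lab (D.repl x l) i = l i := D.lab_eq (D.repl_Mt hi)

theorem Code.repl_congr {x : ℤ → Γ} {l l' : ℤ → L} (h : ∀ i ∈ D.cells x, l i = l' i) :
    D.repl x l = D.repl x l' :=
  Code.repl_unique (fun _ ht => Code.repl_off ht) (fun i hi => by rw [← h i hi]; exact D.repl_Mt hi)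

theorem Code.repl_repl {x : ℤ → Γ} {l l' : ℤ → L} :
    D.repl (D.repl x l) l' = D.repl x l' := by
  symm
  apply Code.repl_unique
  · intro t ht
    rw [Code.cells_repl] at ht
    rw [Code.repl_off ht, Code.repl_off ht]
  · intro i hi
    rw [Code.cells_repl] at hi
    exact D.repl_Mt hi

theorem Code.repl_self [Inhabited L] {x : ℤ → Γ} {l : ℤ → L}
    (h : ∀ i ∈ D.cells x, l i = D.lab x i) : D.repl x l = x :=
  (Code.repl_unique (fun _ _ => rfl) (fun i hi => by rw [h i hi]; exact D.lab_spec hi)).symm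

theorem Code.repl_mem {Q : Type} {M : DFA Γ Q} {X : Set (ℤ → Γ)} (hM : Presents M X)
    {e : Q → Q} (he : ∀ k, kap M (D.enc k) = e) {x : ℤ → Γ} (hx : x ∈ X) (l : ℤ → L) :
    D.repl x l ∈ X := by
  refine multi_surgery hM hx {j | ∃ i ∈ D.cells x, j = i + D.m.length} D.d ?_ ?_ ?_
  · rintro _ ⟨i, hi, rfl⟩ _ ⟨j, hj, rfl⟩ h
    have := D.sep hi.1 hi.2.1 hj.1 (by omega)
    unfold Code.T at this
    omega
  · intro t ht
    apply Code.repl_off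
    intro i hi ha
    refine ht _ ⟨i, hi, rfl⟩ ?_
    unfold Code.area Code.T at ha
    omega
  · rintro _ ⟨i, hi, rfl⟩
    have e1 := Mt_fac (D.repl_Mt (l := l) hi)
    obtain ⟨k, hk⟩ := hi.2.2
    have e2 := Mt_fac hk
    rw [D.enc_len] at e1 e2
    rw [e1, e2, he, he]

/-! Shifting -/

theorem Mt_shift {x : ℤ → Γ} {i : ℤ} {W : List Γ} :
    Mt (shiftMapZ Γ x) i W ↔ Mt x (i + 1) W := by
  unfold Mt shiftMapZ
  have : ∀ t : ℕ, i + t + 1 = i + 1 + t := fun t => by ring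
  simp only [this]

theorem Code.cells_shift {x : ℤ → Γ} {i : ℤ} :
    i ∈ D.cells (shiftMapZ Γ x) ↔ i + 1 ∈ D.cells x := by
  unfold Code.cells
  simp only [Set.mem_ofPred_eq, Mt_shift]
  rw [show i + D.T + 1 = i + 1 + D.T by ring,
    show i + (D.m.length : ℤ) + 1 = i + 1 + D.m.length by ring]

theorem Code.lab_shift [Inhabited L] {x : ℤ → Γ} {i : ℤ} (hi : i + 1 ∈ D.cells x) :
    D.lab (shiftMapZ Γ x) i = D.lab x (i + 1) := by
  apply D.lab_eq
  rw [Mt_shift, show i + (D.m.length : ℤ) + 1 = i + 1 + D.m.length by ring]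
  exact D.lab_spec hi

theorem Code.repl_shift {x : ℤ → Γ} {l : ℤ → L} :
    shiftMapZ Γ (D.repl x l) = D.repl (shiftMapZ Γ x) (fun i => l (i + 1)) := by
  apply Code.repl_unique
  · intro t ht
    apply Code.repl_off
    intro i hi ha
    refine ht (i - 1) (by rw [Code.cells_shift]; simpa using hi) ?_
    unfold Code.area at *
    omega
  · intro i hi
    rw [Code.cells_shift] at hi
    rw [Mt_shift, show i + (D.m.length : ℤ) + 1 = i + 1 + D.m.length by ring]
    exact D.repl_Mt hi

/-! Locality -/

/-- `x` and `y` agree within distance `R` of `t`. -/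
def Agree (R t : ℤ) (x y : ℤ → Γ) : Prop := ∀ u, t - R ≤ u → u ≤ t + R → x u = y u

theorem Agree.symm {R t : ℤ} {x y : ℤ → Γ} (h : Agree R t x y) : Agree R t y x :=
  fun u h1 h2 => (h u h1 h2).symm

theorem Code.cells_local {x y : ℤ → Γ} {R t i : ℤ} (h : Agree R t x y) (h1 : t - R ≤ i)
    (h2 : i + 2 * D.T ≤ t + R) : i ∈ D.cells x ↔ i ∈ D.cells y := by
  have key : ∀ x y : ℤ → Γ, Agree R t x y → i ∈ D.cells x → i ∈ D.cells y := by
    rintro x y h ⟨a, b, l, c⟩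
    refine ⟨Mt_congr (fun u hu => h _ ?_ ?_) a, Mt_congr (fun u hu => h _ ?_ ?_) b,
      l, Mt_congr (fun u hu => h _ ?_ ?_) c⟩ <;> (try rw [D.enc_len] at hu) <;>
      unfold Code.T at * <;> omega
  exact ⟨key x y h, key y x h.symm⟩

theorem Code.lab_local [Inhabited L] {x y : ℤ → Γ} {R t i : ℤ} (h : Agree R t x y)
    (h1 : t - R ≤ i) (h2 : i + 2 * D.T ≤ t + R) (hi : i ∈ D.cells x) :
    D.lab y i = D.lab x i := by
  apply D.lab_eq
  refine Mt_congr (fun u hu => h _ ?_ ?_) (D.lab_spec hi) <;> rw [D.enc_len] at hu <;>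
    unfold Code.T at * <;> omega

theorem Code.repl_local {x y : ℤ → Γ} {l l' : ℤ → L} {R t : ℤ} (h : Agree R t x y)
    (hR : 2 * D.T ≤ R) (hl : ∀ i ∈ D.cells x, D.area i t → l i = l' i) :
    D.repl x l t = D.repl y l' t := by
  have hcell : ∀ i, D.area i t → (i ∈ D.cells x ↔ i ∈ D.cells y) := by
    intro i ha
    apply Code.cells_local h <;> unfold Code.area Code.T at * <;> omega
  by_cases hex : ∃ i ∈ D.cells x, D.area i t
  · obtain ⟨i, hi, ha⟩ := hex
    obtain ⟨u, hu, htu⟩ := Code.area_index ha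
    have e1 := D.repl_Mt (l := l) hi u (by rw [D.enc_len]; exact hu)
    have e2 := D.repl_Mt (l := l') ((hcell i ha).1 hi) u (by rw [D.enc_len]; exact hu)
    rw [← hl i hi ha, e1, ← htu] at e2
    exact Option.some.inj e2
  · push Not at hex
    rw [Code.repl_off hex, Code.repl_off (fun i hi ha => hex i ((hcell i ha).2 hi) ha)]
    apply h <;> unfold Code.T at * <;> omega

end Repl

/-! ### The action of the free group -/

section Action

variable {Γ G : Type} [Group G] (D : Code Γ (ℤˣ → G))

/-- Labels as a function on sites. -/
noncomputable def siteLab (x : ℤ → Γ) : ℤ × ℤˣ → G :=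
  haveI : Inhabited (ℤˣ → G) := ⟨1⟩
  fun s => D.lab x s.1 s.2

/-- The action of a word on points. -/
noncomputable def act (w : FreeGroup (Option G)) (x : ℤ → Γ) : ℤ → Γ :=
  D.repl x (fun i ε => ThetaS (tau (D.cells x) D.T) (Bset (D.cells x) D.T) w (siteLab D x) (i, ε))

variable {D}

theorem siteLab_repl {x : ℤ → Γ} {l : ℤ → ℤˣ → G} {i : ℤ} {ε : ℤˣ} (hi : i ∈ D.cells x) :
    siteLab D (D.repl x l) (i, ε) = l i ε := by
  let : Inhabited (ℤˣ → G) := ⟨1⟩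
  exact congrFun (D.lab_repl hi) ε

theorem repl_eq_self {x : ℤ → Γ} {l : ℤ → ℤˣ → G}
    (h : ∀ i ∈ D.cells x, ∀ ε, l i ε = siteLab D x (i, ε)) : D.repl x l = x := by
  let : Inhabited (ℤˣ → G) := ⟨1⟩
  exact D.repl_self (fun i hi => funext fun ε => h i hi ε)

theorem cells_act (w : FreeGroup (Option G)) (x : ℤ → Γ) : D.cells (act D w x) = D.cells x :=
  Code.cells_repl

theorem Theta_congr (C : Set ℤ) (T : ℤ) (w : FreeGroup (Option G)) {f g : ℤ × ℤˣ → G}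
    (h : ∀ i ∈ C, ∀ ε, f (i, ε) = g (i, ε)) {i : ℤ} (hi : i ∈ C) (ε : ℤˣ) :
    ThetaS (tau C T) (Bset C T) w f (i, ε) = ThetaS (tau C T) (Bset C T) w g (i, ε) := by
  obtain ⟨k, c, l, hw⟩ := exists_NF w
  rw [hw.2, hw.2]
  congr 1
  exact h _ ((tau_zpow_fst_mem (T := T) (i, ε) k).2 hi) _

theorem act_one (x : ℤ → Γ) : act D 1 x = x := by
  apply repl_eq_self
  intro i hi ε
  simp

theorem act_mul (w w' : FreeGroup (Option G)) (x : ℤ → Γ) :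
    act D (w * w') x = act D w (act D w' x) := by
  conv_rhs => rw [act, cells_act]
  conv_rhs => rw [act, Code.repl_repl]
  rw [act]
  apply Code.repl_congr
  intro i hi
  funext ε
  rw [map_mul, Equiv.Perm.mul_apply]
  apply Theta_congr _ _ _ _ hi
  intro j hj η
  rw [siteLab_repl hj]

theorem act_repl (w : FreeGroup (Option G)) (x : ℤ → Γ) (f : ℤ × ℤˣ → G) {i : ℤ}
    (hi : i ∈ D.cells x) (ε : ℤˣ) (h : act D w (D.repl x fun i ε => f (i, ε)) =
      D.repl x fun i ε => f (i, ε)) :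
    ThetaS (tau (D.cells x) D.T) (Bset (D.cells x) D.T) w f (i, ε) = f (i, ε) := by
  have h2 := congrArg (fun z => siteLab D z (i, ε)) h
  simp only [act] at h2
  rw [Code.cells_repl, Code.repl_repl, siteLab_repl hi, siteLab_repl hi] at h2
  rw [← h2]
  apply Theta_congr _ _ _ _ hi
  intro j hj η
  rw [siteLab_repl hj]

theorem siteLab_shift {x : ℤ → Γ} {i : ℤ} {ε : ℤˣ} (hi : i + 1 ∈ D.cells x) :
    siteLab D (shiftMapZ Γ x) (i, ε) = siteLab D x (i + 1, ε) := by
  let : Inhabited (ℤˣ → G) := ⟨1⟩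
  exact congrFun (D.lab_shift hi) ε

theorem siteLab_local {x y : ℤ → Γ} {R t i : ℤ} {ε : ℤˣ} (h : Agree R t x y)
    (h1 : t - R ≤ i) (h2 : i + 2 * D.T ≤ t + R) (hi : i ∈ D.cells x) :
    siteLab D x (i, ε) = siteLab D y (i, ε) := by
  let : Inhabited (ℤˣ → G) := ⟨1⟩
  exact (congrFun (D.lab_local h h1 h2 hi) ε).symm

theorem act_shift_gen (g : Option G) (x : ℤ → Γ) :
    shiftMapZ Γ (act D (FreeGroup.of g) x) = act D (FreeGroup.of g) (shiftMapZ Γ x) := by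
  classical
  rw [act, act, Code.repl_shift]
  apply Code.repl_congr
  intro i hi
  funext ε
  have hi' := Code.cells_shift.1 hi
  have hs : i + ε * D.T ∈ D.cells (shiftMapZ Γ x) ↔ i + 1 + ε * D.T ∈ D.cells x := by
    rw [Code.cells_shift, show i + 1 + ε * D.T = i + ε * D.T + 1 by ring]
  cases g with
  | none =>
    simp only [ThetaS, FreeGroup.lift_apply_of, genS, Equiv.coe_fn_mk]
    by_cases hn : i + ε * D.T ∈ D.cells (shiftMapZ Γ x)
    · rw [tau_step hi hn, tau_step hi' (hs.1 hn), siteLab_shift (Code.cells_shift.1 hn)]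
      congr 2; ring
    · rw [tau_turn hi hn, tau_turn hi' (fun h => hn (hs.2 h)), siteLab_shift hi']
  | some a =>
    simp only [ThetaS, FreeGroup.lift_apply_of, genS, Equiv.coe_fn_mk, Bset, Set.mem_ofPred_eq]
    rw [siteLab_shift hi']
    simp only [hi, hi', hs]

theorem act_local_gen (g : Option G) {x y : ℤ → Γ} {t : ℤ} (h : Agree (5 * D.T) t x y) :
    act D (FreeGroup.of g) x t = act D (FreeGroup.of g) y t := by
  classical
  have hT : 0 ≤ D.T := by unfold Code.T; omega
  refine Code.repl_local h (by omega) ?_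
  intro i hi ha
  have hb : i ≤ t ∧ t < i + D.T := by unfold Code.area at ha; omega
  funext ε
  have hε : -D.T ≤ ε * D.T ∧ ε * D.T ≤ D.T := by
    rcases Int.units_eq_one_or ε with rfl | rfl <;> simp <;> omega
  have hi' : i ∈ D.cells y := (Code.cells_local h (by omega) (by omega)).1 hi
  have hs : i + ε * D.T ∈ D.cells x ↔ i + ε * D.T ∈ D.cells y :=
    Code.cells_local h (by omega) (by omega)
  cases g with
  | none =>
    simp only [ThetaS, FreeGroup.lift_apply_of, genS, Equiv.coe_fn_mk]
    by_cases hn : i + ε * D.T ∈ D.cells x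
    · rw [tau_step hi hn, tau_step hi' (hs.1 hn)]
      exact siteLab_local h (by omega) (by omega) hn
    · rw [tau_turn hi hn, tau_turn hi' (fun h => hn (hs.2 h))]
      exact siteLab_local h (by omega) (by omega) hi
  | some a =>
    simp only [ThetaS, FreeGroup.lift_apply_of, genS, Equiv.coe_fn_mk, Bset, Set.mem_ofPred_eq]
    rw [siteLab_local h (by omega) (by omega) hi]
    simp only [hi, hi', hs]

/-- The permutation action on `X`. -/
noncomputable def psi (D : Code Γ (ℤˣ → G)) (X : Set (ℤ → Γ))
    (hmem : ∀ x ∈ X, ∀ l, D.repl x l ∈ X) : FreeGroup (Option G) →* Equiv.Perm X where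
  toFun w :=
    { toFun := fun x => ⟨act D w x, hmem _ x.2 _⟩
      invFun := fun x => ⟨act D w⁻¹ x, hmem _ x.2 _⟩
      left_inv := fun x => by
        apply Subtype.ext; simp only; rw [← act_mul, inv_mul_cancel, act_one]
      right_inv := fun x => by
        apply Subtype.ext; simp only; rw [← act_mul, mul_inv_cancel, act_one] }
  map_one' := by
    ext x : 2; simp [act_one]
  map_mul' w w' := by
    ext x : 2; simp [act_mul]

theorem psi_apply (X : Set (ℤ → Γ)) (hmem : ∀ x ∈ X, ∀ l, D.repl x l ∈ X)
    (w : FreeGroup (Option G)) (x : X) : (psi D X hmem w x : ℤ → Γ) = act D w x := rfl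

theorem psi_mem [Finite Γ] [TopologicalSpace Γ] [DiscreteTopology Γ] (X : Set (ℤ → Γ))
    (hXc : IsClosed X)
    (hmem : ∀ x ∈ X, ∀ l, D.repl x l ∈ X) (w : FreeGroup (Option G)) :
    psi D X hmem w ∈ SubAut X {shiftMapZ Γ} := by
  induction w using FreeGroup.induction_on with
  | C1 => rw [map_one]; exact one_mem _
  | inv_of x h => rw [map_inv]; exact inv_mem h
  | mul x y hx hy => rw [map_mul]; exact mul_mem hx hy
  | of g =>
    have hcont : Continuous (psi D X hmem (FreeGroup.of g)) := by
      refine Continuous.subtype_mk (continuous_pi fun t => ?_) _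
      rw [continuous_iff_continuousAt]
      intro x
      have hev : ∀ᶠ y : X in nhds x, ∀ u ∈ Set.Icc (t - 5 * D.T) (t + 5 * D.T),
          (x : ℤ → Γ) u = (y : ℤ → Γ) u := by
        rw [Filter.eventually_all_finite (Set.finite_Icc _ _)]
        intro u _
        have hc : Continuous fun y : X => (y : ℤ → Γ) u :=
          (continuous_apply u).comp continuous_subtype_val
        have := hc.continuousAt (x := x)
        filter_upwards [this.eventually_mem ((isOpen_discrete {(x : ℤ → Γ) u}).mem_nhds rfl)]
          with y hy
        exact hy.symm
      apply (tendsto_nhds_of_eventually_eq ?_ : Filter.Tendsto _ _ _)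
      filter_upwards [hev] with y hy
      exact (act_local_gen g (fun u h1 h2 => hy u ⟨h1, h2⟩)).symm
    have hcomm : ∀ x y : X, shiftMapZ Γ x = y →
        shiftMapZ Γ (psi D X hmem (FreeGroup.of g) x) = psi D X hmem (FreeGroup.of g) y := by
      intro x y h
      rw [psi_apply, psi_apply, act_shift_gen, h]
    have : CompactSpace X := isCompact_iff_compactSpace.1 hXc.isCompact
    refine ⟨⟨hcont, ?_⟩, ⟨?_, ?_⟩⟩
    · rintro s rfl x y h; exact hcomm x y h
    · exact (Continuous.homeoOfEquivCompactToT2 (f := psi D X hmem (FreeGroup.of g))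
        hcont).symm.continuous
    · rintro s rfl x y h
      rw [← map_inv]
      rw [psi_apply, psi_apply]
      have e1 : act D (FreeGroup.of g) (shiftMapZ Γ (act D (FreeGroup.of g)⁻¹ x)) = y := by
        rw [← act_shift_gen, ← act_mul, mul_inv_cancel, act_one, h]
      rw [← e1, ← act_mul, inv_mul_cancel, act_one]

end Action

/-! ### Exact belts -/

section ExactBelts

variable {Γ L : Type} (D : Code Γ L)

/-- The word for a belt of exactly `n` cells followed by a dead block. -/
def beltW [Inhabited L] : ℕ → List Γ
  | 0 => D.m ++ (D.enc none ++ D.m)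
  | n + 1 => D.m ++ (D.enc (some default) ++ beltW n)

variable {D}

theorem beltW_kap [Inhabited L] {Q : Type} {M : DFA Γ Q} {e : Q → Q} (he : e ∘ e = e)
    (hm : kap M D.m = e) (hk : ∀ k, kap M (D.enc k) = e) (n : ℕ) : kap M (beltW D n) = e := by
  induction n with
  | zero => rw [beltW, kap_append, kap_append, hm, hk, he, he]
  | succ n ih => rw [beltW, kap_append, kap_append, hm, hk, ih, he, he]

theorem not_cell_of_none {w : ℤ → Γ} {i : ℤ} (h : Mt w (i + D.m.length) (D.enc none)) :
    i ∉ D.cells w := by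
  rintro ⟨_, _, l, hl⟩
  have := D.enc_inj (Mt_unique h hl (by rw [D.enc_len, D.enc_len]))
  cases this

theorem Mt_beltW [Inhabited L] {w : ℤ → Γ} (n : ℕ) (i : ℤ) (h : Mt w i (beltW D n)) :
    (∀ u : ℕ, u < n → i + u * D.T ∈ D.cells w) ∧ i + n * D.T ∉ D.cells w ∧ Mt w i D.m := by
  induction n generalizing i with
  | zero =>
    rw [beltW] at h
    obtain ⟨h1, h2⟩ := Mt_append.1 h
    refine ⟨fun u hu => by omega, ?_, h1⟩
    simpa using not_cell_of_none (Mt_append.1 h2).1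
  | succ n ih =>
    rw [beltW] at h
    obtain ⟨h1, h2⟩ := Mt_append.1 h
    obtain ⟨h3, h4⟩ := Mt_append.1 h2
    rw [D.enc_len, show i + (D.m.length : ℤ) + D.d = i + D.T by unfold Code.T; ring] at h4
    obtain ⟨a, b, c⟩ := ih _ h4
    refine ⟨fun u hu => ?_, ?_, h1⟩
    · cases u with
      | zero =>
        have hc : i ∈ D.cells w := ⟨h1, c, _, h3⟩
        rwa [Nat.cast_zero, zero_mul, add_zero]
      | succ u =>
        have := a u (by omega)
        rwa [show i + ((u + 1 : ℕ) : ℤ) * D.T = i + D.T + u * D.T by push_cast; ring]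
    · rwa [show i + ((n + 1 : ℕ) : ℤ) * D.T = i + D.T + n * D.T by push_cast; ring]

theorem exists_insert {Q : Type} {M : DFA Γ Q} {X : Set (ℤ → Γ)} (hM : Presents M X)
    {x : ℤ → Γ} (hx : x ∈ X) (i : ℤ) (n : ℕ) (W : List Γ)
    (h : kap M W = kap M (fac x i n)) : ∃ y ∈ X, Mt y i W := by
  let y : ℤ → Γ := fun t => if t < i then x t else
    (W[(t - i).toNat]?).getD (x (t - W.length + n))
  have hy : Mt y i W := by
    intro t ht
    have h1 : ¬ (i + (t : ℤ) < i) := by omega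
    have h2 : (i + (t : ℤ) - i).toNat = t := by omega
    simp only [y, if_neg h1, h2]
    rw [List.getElem?_eq_getElem ht]
    simp
  refine ⟨y, surgery hM hx i n W.length ?_ ?_ ?_, hy⟩
  · intro t ht
    simp only [y, if_pos ht]
  · intro t ht
    have h1 : ¬ (t + (W.length : ℤ) < i) := by omega
    simp only [y, if_neg h1]
    rw [List.getElem?_eq_none (by omega)]
    simp
  · rw [Mt_fac hy, h]

theorem exists_belt [Inhabited L] {Q : Type} {M : DFA Γ Q} {X : Set (ℤ → Γ)} (hM : Presents M X)
    {x : ℤ → Γ} (hx : x ∈ X) {i : ℤ} {n0 : ℕ} {e : Q → Q} (he : e ∘ e = e)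
    (hfac : kap M (fac x i n0) = e)
    (hm : kap M D.m = e) (hk : ∀ k, kap M (D.enc k) = e) {n : ℕ} (hn : 0 < n) :
    ∃ y ∈ X, ∃ s : ℤ × ℤˣ, s ∈ Bn (D.cells y) D.T n := by
  obtain ⟨y, hy, hW⟩ := exists_insert hM hx i n0 (D.m ++ (D.enc none ++ beltW D n))
    (by rw [kap_append, kap_append, hm, hk, beltW_kap he hm hk, he, he, hfac])
  obtain ⟨h1, h2⟩ := Mt_append.1 hW
  obtain ⟨h3, h4⟩ := Mt_append.1 h2
  rw [D.enc_len, show i + (D.m.length : ℤ) + D.d = i + D.T by unfold Code.T; ring] at h4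
  obtain ⟨a, b, c⟩ := Mt_beltW _ _ h4
  refine ⟨y, hy, (i + D.T, -1), ⟨?_, ?_⟩, ?_, ?_⟩
  · simpa using a 0 hn
  · simpa using not_cell_of_none h3
  · intro u hu
    simpa using a u hu
  · simpa using b

end ExactBelts

/-! ### The group `WreathZ` as a quotient of the free group -/

section Final

variable {G : Type} [Group G]

/-- Presentation map onto `WreathZ`. -/
def chi (G : Type) [Group G] (N : Set ℕ) : FreeGroup (Option G) →* WreathZ G N :=
  FreeGroup.lift fun o => match o with
    | none => ⟨rot G N, rot_mem⟩
    | some a => ⟨rho a, rho_mem a⟩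

theorem chi_of {N : Set ℕ} (o : Option G) : chi G N (FreeGroup.of o) =
    (match o with
    | none => ⟨rot G N, rot_mem⟩
    | some a => ⟨rho a, rho_mem a⟩ : WreathZ G N) := FreeGroup.lift_apply_of

theorem chi_surj (N : Set ℕ) : Function.Surjective (chi G N) := by
  have h : ((WreathZ G N).subtype.comp (chi G N)).range = WreathZ G N := by
    apply le_antisymm
    · rintro _ ⟨w, rfl⟩
      exact (chi G N w).2
    · unfold WreathZ
      rw [Subgroup.closure_le]
      rintro z (rfl | ⟨a, rfl⟩)
      · exact ⟨FreeGroup.of none, congrArg Subtype.val (chi_of none)⟩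
      · exact ⟨FreeGroup.of (some a), congrArg Subtype.val (chi_of (some a))⟩
  rintro ⟨z, hz⟩
  rw [← h] at hz
  obtain ⟨w, hw⟩ := hz
  exact ⟨w, Subtype.ext hw⟩

theorem chi_apply (N : Set ℕ) (w : FreeGroup (Option G)) (n : N) (f : Fin n → G) :
    (chi G N w : Equiv.Perm (SN G N)) ⟨n, f⟩ =
      ⟨n, ThetaS (finRotate n) {t : Fin n | (t : ℕ) = 0} w f⟩ := by
  have h : (WreathZ G N).subtype.comp (chi G N) =
      (Equiv.Perm.sigmaCongrRightHom (fun n : N => (Fin n → G))).comp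
        (MonoidHom.pi fun n : N => ThetaS (finRotate n) {t : Fin n | (t : ℕ) = 0}) := by
    apply FreeGroup.ext_hom
    intro o
    cases o with
    | none =>
      ext ⟨n, f⟩ : 1
      refine (congrArg (fun z : WreathZ G N => z.1 ⟨n, f⟩) (chi_of none)).trans ?_
      refine Sigma.ext rfl (heq_of_eq ?_)
      change _ = ThetaS (finRotate n) {t : Fin n | (t : ℕ) = 0} (FreeGroup.of none) f
      rw [ThetaS, FreeGroup.lift_apply_of]
      rfl
    | some a =>
      ext ⟨n, f⟩ : 1
      refine (congrArg (fun z : WreathZ G N => z.1 ⟨n, f⟩) (chi_of (some a))).trans ?_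
      refine Sigma.ext rfl (heq_of_eq ?_)
      change _ = ThetaS (finRotate n) {t : Fin n | (t : ℕ) = 0} (FreeGroup.of (some a)) f
      rw [ThetaS, FreeGroup.lift_apply_of]
      funext i
      change (if (i : ℕ) = 0 then Equiv.mulLeft a else Equiv.refl G) (f i) = _
      by_cases hi : (i : ℕ) = 0 <;> simp [hi, genS]
  exact congrArg (fun z => z ⟨n, f⟩) (DFunLike.congr_fun h w)

theorem chi_eq_one_iff (w : FreeGroup (Option G)) :
    chi G {n : ℕ | 0 < n} w = 1 ↔
      ∀ n : ℕ, 0 < n → ∀ f s, ThetaS (finRotate n) {t : Fin n | (t : ℕ) = 0} w f s = f s := by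
  constructor
  · intro h n hn f s
    have := chi_apply {n : ℕ | 0 < n} w ⟨n, hn⟩ f
    rw [h] at this
    simp only [OneMemClass.coe_one, Equiv.Perm.coe_one, id] at this
    have := eq_of_heq (Sigma.mk.inj this).2
    exact (congrFun this s).symm
  · intro h
    apply Subtype.ext
    ext ⟨n, f⟩ : 1
    rw [chi_apply]
    simp only [OneMemClass.coe_one, Equiv.Perm.coe_one, id]
    congr 1
    funext s
    exact h n n.2 f s

theorem act_trivial_of_chi [Nontrivial G] {Γ : Type} (D : Code Γ (ℤˣ → G))
    (w : FreeGroup (Option G))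
    (h : ∀ n : ℕ, 0 < n → ∀ f s, ThetaS (finRotate n) {t : Fin n | (t : ℕ) = 0} w f s = f s)
    (x : ℤ → Γ) : act D w x = x := by
  obtain ⟨k, c, l, hw⟩ := exists_NF w
  have hk : k = 0 := by
    have hn : 0 < k.natAbs + 1 := by omega
    have := (hw.trivial (finRotate (k.natAbs + 1)) _ ⟨0, hn⟩ (fun f => h _ hn f _)).2
    have h2 := finRotate_zpow_val hn ⟨0, hn⟩ k
    rw [this] at h2
    simp only [Nat.cast_zero, zero_add] at h2
    have h3 := Int.dvd_of_emod_eq_zero h2.symm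
    have h4 := Int.eq_zero_of_abs_lt_dvd h3 (by push_cast; omega)
    exact h4
  apply repl_eq_self
  intro i hi ε
  rw [hw.2, hk]
  have hc : c (patt (tau (D.cells x) D.T) (Bset (D.cells x) D.T) (i, ε)) = 1 := by
    obtain ⟨n, hn, j, hj⟩ := patt_window (D.cells x) D.T (i, ε) l
    have hn' : (0 : ℤ) < n := by exact_mod_cast hn
    have hj0 := Int.emod_nonneg j hn'.ne'
    have hj1 := Int.emod_lt_of_pos j hn'
    let s : Fin n := ⟨(j % n).toNat, by omega⟩
    have hs : ((s : ℕ) : ℤ) = j % n := by simp only [s]; omega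
    have h1 := (hw.trivial (finRotate n) _ s (fun f => h _ hn f s)).1
    rw [patt_fin hn] at h1
    rw [← h1]
    apply hw.1
    intro m hm
    rw [hj m hm, Set.mem_ofPred_eq, hs]
    have : m + j = m + j % n + n * (j / n) := by have := Int.emod_add_mul_ediv j n; linarith
    rw [this]
    exact (Int.dvd_add_left (Dvd.intro _ rfl))
  rw [hc]; simp

theorem chi_of_act_trivial [Nontrivial G] {Γ : Type} (D : Code Γ (ℤˣ → G)) (X : Set (ℤ → Γ))
    (hmem : ∀ x ∈ X, ∀ l, D.repl x l ∈ X) (w : FreeGroup (Option G))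
    (h : ∀ x ∈ X, act D w x = x) {n : ℕ} (hn : 0 < n)
    (hb : ∃ y ∈ X, ∃ s : ℤ × ℤˣ, s ∈ Bn (D.cells y) D.T n) (f : Fin n → G) (s : Fin n) :
    ThetaS (finRotate n) {t : Fin n | (t : ℕ) = 0} w f s = f s := by
  obtain ⟨y, hy, s0, hs0⟩ := hb
  obtain ⟨k, c, l, hw⟩ := exists_NF w
  have hp := patt_Bn hs0 hn
  have htriv : ∀ s' : ℤ × ℤˣ, s'.1 ∈ D.cells y → ∀ g,
      ThetaS (tau (D.cells y) D.T) (Bset (D.cells y) D.T) w g s' = g s' := by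
    rintro ⟨i, ε⟩ hi g
    exact act_repl w y g hi ε (h _ (hmem y hy _))
  have hs0C : s0.1 ∈ D.cells y := hs0.1.1
  have hk := (hw.trivial _ _ s0 (htriv s0 hs0C)).2
  have hnk : (n : ℤ) ∣ k := by
    have : k ∈ patt (tau (D.cells y) D.T) (Bset (D.cells y) D.T) s0 := by
      change (tau (D.cells y) D.T ^ k) s0 ∈ Bset (D.cells y) D.T
      rw [hk]; exact hs0.1
    rw [hp] at this
    exact this
  have hc := (hw.trivial _ _ ((tau (D.cells y) D.T ^ (s : ℤ)) s0)
    (htriv _ ((tau_zpow_fst_mem _ _).2 hs0C))).1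
  rw [patt_zpow, hp] at hc
  rw [hw.2, patt_fin hn]
  have : (finRotate n ^ k) s = s := by
    apply Fin.ext
    have := finRotate_zpow_val hn s k
    obtain ⟨b, rfl⟩ := hnk
    rw [Int.add_mul_emod_self_left, Int.emod_eq_of_lt (by omega) (by omega)] at this
    exact_mod_cast this
  rw [this]
  have hc' : c {m : ℤ | (n : ℤ) ∣ m + s} = 1 := hc
  rw [hc', one_mul]

end Final

theorem stmt10 (Γ : Type) [Fintype Γ] [TopologicalSpace Γ] [DiscreteTopology Γ]
    (X : Set (ℤ → Γ)) (hX : IsSoficShift X) (hunc : ¬X.Countable) :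
    ∃ φ : WreathZ A5 {n : ℕ | 0 < n} →* SubAut X {shiftMapZ Γ},
      Function.Injective φ := by
  obtain ⟨Q, _, M, hM⟩ := exists_presents hX
  obtain ⟨x, hx, i, n0, p, q, e, he, hfac, hp, hq, hlen, hne⟩ := exists_idem_words M X hunc
  have hA : Nontrivial A5 := alternatingGroup.nontrivial_of_three_le_card (by simp)
  obtain ⟨D, hm, hk⟩ := exists_code he hp hq hlen hne (ℤˣ → A5)
  have hmem : ∀ x ∈ X, ∀ l, D.repl x l ∈ X := fun x hx l => Code.repl_mem hM hk hx l
  let : Inhabited (ℤˣ → A5) := ⟨1⟩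
  let ψ : FreeGroup (Option A5) →* SubAut X {shiftMapZ Γ} :=
    (psi D X hmem).codRestrict _ (psi_mem X hX.1 hmem)
  have hker : ∀ w, ψ w = 1 ↔ chi A5 {n : ℕ | 0 < n} w = 1 := by
    intro w
    rw [chi_eq_one_iff]
    have e1 : ψ w = 1 ↔ ∀ x ∈ X, act D w x = x := by
      constructor
      · intro h x hx
        have h2 : psi D X hmem w = 1 := congrArg Subtype.val h
        have h3 := psi_apply X hmem w ⟨x, hx⟩
        rw [h2] at h3
        exact h3.symm
      · intro h
        apply Subtype.ext
        ext x : 2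
        exact h x x.2
    rw [e1]
    constructor
    · intro h n hn f s
      exact chi_of_act_trivial D X hmem w h hn (exists_belt hM hx he hfac hm hk hn) f s
    · intro h x _
      exact act_trivial_of_chi D w h x
  let φ := (chi A5 {n : ℕ | 0 < n}).liftOfSurjective (chi_surj _)
    ⟨ψ, fun w hw => (hker w).2 hw⟩
  have hφ : ∀ w, φ (chi A5 _ w) = ψ w := fun w =>
    MonoidHom.liftOfRightInverse_comp_apply _ _ _ ⟨ψ, fun w hw => (hker w).2 hw⟩ w
  refine ⟨φ, (injective_iff_map_eq_one φ).2 fun z hz => ?_⟩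
  obtain ⟨w, rfl⟩ := chi_surj _ z
  rw [hφ] at hz
  exact (hker w).1 hz
end

section
/- Let Σ be a finite alphabet and X ⊆ Σ^ℤ an uncountable sofic shift. Then Aut(X) does not satisfy the Tits alternative: it has a finitely generated subgroup which is not virtually solvable and which contains no subgroup isomorphic to the free group on two generators. -/
namespace TitsCA

/-! ### Words and the finite profile of a regular language -/

def word {Γ : Type} (x : ℤ → Γ) (a : ℤ) (k : ℕ) : List Γ :=
  (List.range k).map fun t : ℕ => x (a + t)

@[simp] theorem word_length {Γ : Type} (x : ℤ → Γ) (a : ℤ) (k : ℕ) :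
    (word x a k).length = k := by simp [word]

theorem word_add {Γ : Type} (x : ℤ → Γ) (a : ℤ) (k l : ℕ) :
    word x a (k + l) = word x a k ++ word x (a + k) l := by
  unfold word
  rw [List.range_add, List.map_append, List.map_map]
  congr 1
  apply List.map_congr_left
  intro t _
  simp [add_assoc]

theorem word_congr {Γ : Type} {x y : ℤ → Γ} {a b : ℤ} {k : ℕ}
    (h : ∀ t : ℕ, t < k → x (a + t) = y (b + t)) : word x a k = word y b k := by
  apply List.map_congr_left
  intro t ht
  exact h t (List.mem_range.1 ht)

theorem word_get {Γ : Type} {x y : ℤ → Γ} {a b : ℤ} {k : ℕ}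
    (h : word x a k = word y b k) {t : ℕ} (ht : t < k) : x (a + t) = y (b + t) := by
  have := congrArg (fun l => l[t]?) h
  simpa [word, ht] using this

/-- a word containing a (nonempty) forbidden factor -/
def Bad {Γ : Type} (L : Language Γ) (w : List Γ) : Prop :=
  ∃ a b c : List Γ, w = a ++ b ++ c ∧ b ≠ [] ∧ b ∈ L

theorem Bad.mono {Γ : Type} {L : Language Γ} {w : List Γ} (h : Bad L w) (a c : List Γ) :
    Bad L (a ++ w ++ c) := by
  obtain ⟨a', b, c', rfl, hb, hL⟩ := h
  exact ⟨a ++ a', b, c' ++ c, by simp, hb, hL⟩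

theorem Bad.snoc_iff {Γ : Type} {L : Language Γ} {w : List Γ} {g : Γ} :
    Bad L (w ++ [g]) ↔ Bad L w ∨ ∃ a b : List Γ, w ++ [g] = a ++ b ∧ b ≠ [] ∧ b ∈ L := by
  constructor
  · rintro ⟨a, b, c, h, hb, hL⟩
    rcases List.eq_nil_or_concat c with rfl | ⟨c', z, rfl⟩
    · right
      exact ⟨a, b, by simpa using h, hb, hL⟩
    · left
      refine ⟨a, b, c', ?_, hb, hL⟩
      have h' : w ++ [g] = (a ++ b ++ c') ++ [z] := by simpa using h
      exact (List.append_inj' h' rfl).1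
  · rintro (h | ⟨a, b, h, hb, hL⟩)
    · simpa using h.mono [] [g]
    · exact ⟨a, b, [], by simpa using h, hb, hL⟩

/-- subset automaton step, remembering whether a forbidden word has been seen -/
def pstep {Γ S : Type} (M : DFA Γ S) (q : Set S × Prop) (g : Γ) : Set S × Prop :=
  let A : Set S := {s | ∃ r, (r ∈ q.1 ∨ r = M.start) ∧ M.step r g = s}
  (A, q.2 ∨ ∃ s ∈ A, s ∈ M.accept)

theorem pstep_fst {Γ S : Type} (M : DFA Γ S) (w : List Γ) (s : S) :
    s ∈ (w.foldl (pstep M) (∅, False)).1 ↔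
      ∃ a b : List Γ, w = a ++ b ∧ b ≠ [] ∧ M.eval b = s := by
  induction w using List.reverseRecOn generalizing s with
  | nil => simp
  | append_singleton w g ih =>
    rw [List.foldl_append]
    simp only [List.foldl_cons, List.foldl_nil, pstep, Set.mem_ofPred_eq]
    constructor
    · rintro ⟨r, hr | rfl, rfl⟩
      · obtain ⟨a, b, rfl, hb, rfl⟩ := (ih r).1 hr
        exact ⟨a, b ++ [g], by simp, by simp, by simp⟩
      · exact ⟨w, [g], rfl, by simp, by simp⟩
    · rintro ⟨a, b, h, hb, rfl⟩
      rcases List.eq_nil_or_concat b with rfl | ⟨b', z, rfl⟩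
      · exact absurd rfl hb
      · have h' : w ++ [g] = (a ++ b') ++ [z] := by simpa using h
        obtain ⟨h1, h2⟩ := List.append_inj' h' rfl
        obtain rfl : g = z := by simpa using h2
        refine ⟨M.eval b', ?_, by simp⟩
        by_cases hb' : b' = []
        · right; simp [hb']
        · left; exact (ih _).2 ⟨a, b', h1, hb', rfl⟩

theorem pstep_snd {Γ S : Type} (M : DFA Γ S) (w : List Γ) :
    (w.foldl (pstep M) (∅, False)).2 ↔ Bad M.accepts w := by
  induction w using List.reverseRecOn with
  | nil =>
    simp only [List.foldl_nil, false_iff]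
    rintro ⟨a, b, c, h, hb, -⟩
    simp at h
    exact hb h.2.1
  | append_singleton w g ih =>
    rw [Bad.snoc_iff, ← ih]
    have key := pstep_fst M (w ++ [g])
    rw [List.foldl_append] at key ⊢
    simp only [List.foldl_cons, List.foldl_nil] at key ⊢
    have : (pstep M (List.foldl (pstep M) (∅, False) w) g).2 ↔
      ((List.foldl (pstep M) (∅, False) w).2 ∨
        ∃ s ∈ (pstep M (List.foldl (pstep M) (∅, False) w) g).1, s ∈ M.accept) := Iff.rfl
    rw [this]
    apply or_congr Iff.rfl
    constructor
    · rintro ⟨s, hs, hacc⟩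
      obtain ⟨a, b, h, hb, rfl⟩ := (key s).1 hs
      exact ⟨a, b, h, hb, hacc⟩
    · rintro ⟨a, b, h, hb, hacc⟩
      exact ⟨M.eval b, (key _).2 ⟨a, b, h, hb, rfl⟩, hacc⟩

/-- A finite two-sided profile. -/
structure Profile {Γ : Type} (L : Language Γ) (F : Type) where
  toFun : List Γ → F
  congr : ∀ a a' b b', toFun a = toFun a' → toFun b = toFun b' → toFun (a ++ b) = toFun (a' ++ b')
  bad : ∀ a b, toFun a = toFun b → Bad L a → Bad L b

theorem exists_profile {Γ : Type} {L : Language Γ} (hL : L.IsRegular) :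
    ∃ (F : Type) (_ : Finite F), Nonempty (Profile L F) := by
  obtain ⟨S, _, M, rfl⟩ := hL
  refine ⟨Set S × Prop → Set S × Prop, inferInstance, ⟨⟨fun w q => w.foldl (pstep M) q, ?_, ?_⟩⟩⟩
  · intro a a' b b' h1 h2
    funext q
    simp only [List.foldl_append]
    rw [congrFun h1 q, congrFun h2 _]
  · intro a b h
    rw [← pstep_snd, ← pstep_snd]
    have h2 : a.foldl (pstep M) (∅, False) = b.foldl (pstep M) (∅, False) := congrFun h (∅, False)
    rw [h2]
    exact id

/-! ### Branching words -/

/-- `w` is a concatenation of copies of `a` and `b` -/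
inductive Gen {Γ : Type} (a b : List Γ) : List Γ → Prop
  | nil : Gen a b []
  | left (w) : Gen a b w → Gen a b (a ++ w)
  | right (w) : Gen a b w → Gen a b (b ++ w)

theorem Gen.append {Γ : Type} {a b w w' : List Γ} (h : Gen a b w) (h' : Gen a b w') :
    Gen a b (w ++ w') := by
  induction h with
  | nil => simpa using h'
  | left w _ ih => rw [List.append_assoc]; exact Gen.left _ ih
  | right w _ ih => rw [List.append_assoc]; exact Gen.right _ ih

def rep {Γ : Type} (a : List Γ) : ℕ → List Γ
  | 0 => []
  | k + 1 => a ++ rep a k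

theorem Gen.rep {Γ : Type} {a b w : List Γ} (h : Gen a b w) (k : ℕ) : Gen a b (rep w k) := by
  induction k with
  | zero => exact Gen.nil
  | succ k ih => exact h.append ih

theorem rep_length {Γ : Type} (a : List Γ) (k : ℕ) : (rep a k).length = k * a.length := by
  induction k with
  | zero => simp [TitsCA.rep]
  | succ k ih => simp [TitsCA.rep, ih]; ring

theorem rep_add {Γ : Type} (a : List Γ) (k l : ℕ) : rep a (k + l) = rep a k ++ rep a l := by
  induction k with
  | zero => simp [TitsCA.rep]
  | succ k ih => rw [Nat.succ_add]; simp [TitsCA.rep, ih]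

/-- the data extracted from an uncountable sofic shift -/
def Branch {Γ F : Type} {L : Language Γ} (P : Profile L F) : Prop :=
  ∃ u v : List Γ, u ≠ v ∧ u.length = v.length ∧ P.toFun u = P.toFun v ∧ ∀ k, ¬ Bad L (rep u k)

theorem branch_of_gen {Γ F : Type} [Finite F] {L : Language Γ} (P : Profile L F)
    {a b : List Γ} (hab : a ≠ b) (hlen : a.length = b.length)
    (hg : ∀ w, Gen a b w → ¬ Bad L w) : Branch P := by
  obtain ⟨m, ⟨e⟩⟩ := Finite.exists_equiv_fin F
  let U : Fin (m + 1) → List Γ := fun i => rep a i ++ (b ++ rep a (m - i))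
  have hU : ∀ i, Gen a b (U i) := by
    intro i
    have ha : Gen a b a := by simpa using Gen.left (a := a) (b := b) [] Gen.nil
    exact (ha.rep _).append (Gen.right _ (ha.rep _))
  have hUl : ∀ i, (U i).length = (m + 1) * a.length := by
    intro i
    have hi := i.2
    simp only [U, List.length_append, rep_length, ← hlen]
    have h3 : m + 1 = (i : ℕ) + (1 + (m - (i : ℕ))) := by omega
    calc (i : ℕ) * a.length + (a.length + (m - (i : ℕ)) * a.length)
        = ((i : ℕ) + (1 + (m - (i : ℕ)))) * a.length := by ring
      _ = (m + 1) * a.length := by rw [← h3]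
  have hne : ∀ i j : Fin (m + 1), i < j → U i ≠ U j := by
    intro i j hij h
    have hij' : (i : ℕ) < j := hij
    have : (j : ℕ) = i + ((j - i - 1) + 1) := by omega
    simp only [U] at h
    rw [this, rep_add, List.append_assoc] at h
    have h := List.append_cancel_left h
    simp only [TitsCA.rep, List.append_assoc] at h
    exact hab (List.append_inj h hlen.symm).1.symm
  have : ¬ Function.Injective (fun i => e (P.toFun (U i))) := by
    intro hinj
    have := Fintype.card_le_of_injective _ hinj
    simp at this
  rw [Function.Injective] at this
  push Not at this
  obtain ⟨i, j, hij, hne'⟩ := this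
  have hij := e.injective hij
  rcases lt_or_gt_of_ne hne' with h | h
  · exact ⟨U i, U j, hne _ _ h, by rw [hUl, hUl], hij, fun k => hg _ ((hU i).rep k)⟩
  · exact ⟨U i, U j, (hne _ _ h).symm, by rw [hUl, hUl], hij, fun k => hg _ ((hU i).rep k)⟩

theorem loop_right {Γ F : Type} [Finite F] {L : Language Γ} (P : Profile L F) (hP : ¬ Branch P)
    {f a b : List Γ} (hf : ¬ Bad L f) (hlen : a.length = b.length)
    (ha : P.toFun (f ++ a) = P.toFun f) (hb : P.toFun (f ++ b) = P.toFun f) : a = b := by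
  by_contra hab
  apply hP
  apply branch_of_gen P hab hlen
  intro w hw hbad
  have key : P.toFun (f ++ w) = P.toFun f := by
    clear hbad
    induction hw with
    | nil => simp
    | left w _ ih =>
      rw [← List.append_assoc, ← ih]
      rw [P.congr (f ++ a) f w w ha rfl]
    | right w _ ih =>
      rw [← List.append_assoc, ← ih]
      rw [P.congr (f ++ b) f w w hb rfl]
  exact hf (P.bad _ _ key (by simpa using hbad.mono f []))

theorem loop_left {Γ F : Type} [Finite F] {L : Language Γ} (P : Profile L F) (hP : ¬ Branch P)
    {f a b : List Γ} (hf : ¬ Bad L f) (hlen : a.length = b.length)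
    (ha : P.toFun (a ++ f) = P.toFun f) (hb : P.toFun (b ++ f) = P.toFun f) : a = b := by
  by_contra hab
  apply hP
  apply branch_of_gen P hab hlen
  intro w hw hbad
  have key : P.toFun (w ++ f) = P.toFun f := by
    clear hbad
    induction hw with
    | nil => simp
    | left w _ ih =>
      rw [List.append_assoc, P.congr a a _ _ rfl ih, ha]
    | right w _ ih =>
      rw [List.append_assoc, P.congr b b _ _ rfl ih, hb]
  exact hf (P.bad _ _ key (by simpa using hbad.mono [] f))

/-- the subshift avoiding bad words -/
def SX {Γ : Type} (L : Language Γ) : Set (ℤ → Γ) := {x | ∀ i k, ¬ Bad L (word x i k)}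

theorem right_periodic {Γ F : Type} [Finite F] {L : Language Γ} (P : Profile L F)
    (hP : ¬ Branch P) {x : ℤ → Γ} (hx : x ∈ SX L) :
    ∃ (j : ℤ) (l : ℕ), 0 ≤ j ∧ 0 < l ∧ ∀ z, j ≤ z → x (z + l) = x z := by
  obtain ⟨c, hc⟩ := Finite.exists_infinite_fiber (fun j : ℕ => P.toFun (word x 0 j))
  rw [Set.infinite_coe_iff] at hc
  obtain ⟨j0, hj0⟩ := hc.nonempty
  obtain ⟨j1, hj1, h01⟩ := hc.exists_gt j0
  have hloop : ∀ j, j ∈ (fun j : ℕ => P.toFun (word x 0 j)) ⁻¹' {c} → j0 < j →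
      P.toFun (word x 0 j0 ++ word x j0 (j - j0)) = P.toFun (word x 0 j0) := by
    intro j hj hlt
    have := word_add x 0 j0 (j - j0)
    rw [zero_add] at this
    rw [← this, show j0 + (j - j0) = j by omega]
    exact hj.trans hj0.symm
  refine ⟨j0, j1 - j0, by omega, by omega, ?_⟩
  intro z hz
  obtain ⟨t, ht⟩ := Int.eq_ofNat_of_zero_le (show 0 ≤ z - j0 by omega)
  obtain rfl : z = (j0 : ℤ) + t := by omega
  obtain ⟨j, hj, hjlt⟩ := hc.exists_gt (j0 + t + (j1 - j0))
  set l := j1 - j0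
  have ha := hloop j1 hj1 h01
  have hb := hloop j hj (by omega)
  have hcomm : word x j0 l ++ word x j0 (j - j0) = word x j0 (j - j0) ++ word x j0 l := by
    apply loop_right P hP (hx 0 j0)
    · simp [add_comm]
    · rw [← List.append_assoc, P.congr _ _ _ _ ha rfl, hb]
    · rw [← List.append_assoc, P.congr _ _ _ _ hb rfl, ha]
  have := congrArg (fun w => w[l + t]?) hcomm
  rw [List.getElem?_append_right (by simp), List.getElem?_append_left (by simp; omega)] at this
  simp only [word_length, Nat.add_sub_cancel_left] at this
  have h1 : t < j - j0 := by omega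
  have h2 : l + t < j - j0 := by omega
  simp [word, h1, h2] at this
  rw [this]
  congr 1
  ring

theorem left_periodic {Γ F : Type} [Finite F] {L : Language Γ} (P : Profile L F)
    (hP : ¬ Branch P) {x : ℤ → Γ} (hx : x ∈ SX L) :
    ∃ (j : ℤ) (l : ℕ), j ≤ 0 ∧ 0 < l ∧ ∀ z, z < j → x (z - l) = x z := by
  obtain ⟨c, hc⟩ := Finite.exists_infinite_fiber (fun j : ℕ => P.toFun (word x (-j) j))
  rw [Set.infinite_coe_iff] at hc
  obtain ⟨j0, hj0⟩ := hc.nonempty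
  obtain ⟨j1, hj1, h01⟩ := hc.exists_gt j0
  have hloop : ∀ j, j ∈ (fun j : ℕ => P.toFun (word x (-j) j)) ⁻¹' {c} → j0 < j →
      P.toFun (word x (-j) (j - j0) ++ word x (-j0) j0) = P.toFun (word x (-j0) j0) := by
    intro j hj hlt
    have := word_add x (-j) (j - j0) j0
    rw [show (-j : ℤ) + (j - j0 : ℕ) = -j0 by omega] at this
    rw [← this, show (j - j0) + j0 = j by omega]
    exact hj.trans hj0.symm
  refine ⟨-j0, j1 - j0, by omega, by omega, ?_⟩
  intro z hz
  obtain ⟨t, ht⟩ := Int.eq_ofNat_of_zero_le (show 0 ≤ -j0 - 1 - z by omega)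
  obtain rfl : z = -j0 - 1 - (t : ℤ) := by omega
  obtain ⟨j, hj, hjlt⟩ := hc.exists_gt (j0 + t + (j1 - j0))
  set l := j1 - j0 with hl
  have ha := hloop j1 hj1 h01
  have hb := hloop j hj (by omega)
  have hcomm : word x (-j1) l ++ word x (-j) (j - j0) = word x (-j) (j - j0) ++ word x (-j1) l := by
    apply loop_left P hP (hx (-j0) j0)
    · simp [add_comm]
    · rw [List.append_assoc, P.congr _ _ _ _ rfl hb, ha]
    · rw [List.append_assoc, P.congr _ _ _ _ rfl ha, hb]
  -- compare letter number `j - j0 - 1 - t`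
  have h3 : l + t < j - j0 := by omega
  have := congrArg (fun w => w[j - j0 - 1 - t]?) hcomm
  rw [List.getElem?_append_right (by simp; omega), List.getElem?_append_left (by simp; omega)]
    at this
  simp only [word_length] at this
  have h1 : j - j0 - 1 - t - l < j - j0 := by omega
  have h2 : j - j0 - 1 - t < j - j0 := by omega
  simp only [word, List.getElem?_map, List.getElem?_range h1, List.getElem?_range h2,
    Option.map_some, Option.some.injEq] at this
  convert this using 2 <;> omega

theorem countable_of_not_branch {Γ F : Type} [Finite Γ] [Finite F] {L : Language Γ}
    (P : Profile L F) (hP : ¬ Branch P) : (SX L).Countable := by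
  let A : (ℤ × ℕ) × (ℤ × ℕ) → Set (ℤ → Γ) := fun q =>
    {x | (0 ≤ q.1.1 ∧ 0 < q.1.2 ∧ ∀ z, q.1.1 ≤ z → x (z + q.1.2) = x z) ∧
      (q.2.1 ≤ 0 ∧ 0 < q.2.2 ∧ ∀ z, z < q.2.1 → x (z - q.2.2) = x z)}
  have hA : ∀ q, (A q).Countable := by
    rintro ⟨⟨j, l⟩, ⟨j', l'⟩⟩
    apply Set.Finite.countable
    apply Set.Finite.of_finite_image (f := fun x (i : Set.Icc (j' - l') (j + l)) => x i)
      (Set.toFinite _)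
    rintro x ⟨⟨hj, hl, hx⟩, hj', hl', hx'⟩ y ⟨⟨-, -, hy⟩, -, -, hy'⟩ hxy
    simp only at hj hj' hl hx hl' hx' hy hy'
    have h0 : ∀ z, j' - l' ≤ z → z ≤ j + l → x z = y z := fun z h1 h2 =>
      congrFun hxy ⟨z, h1, h2⟩
    have hR : ∀ n : ℕ, ∀ z, j' - l' ≤ z → z ≤ j + n → x z = y z := by
      intro n
      induction n using Nat.strong_induction_on with
      | _ n ih =>
        intro z h1 h2
        by_cases hz : z ≤ j + l
        · exact h0 z h1 hz
        · have e1 := hx (z - l) (by omega)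
          have e2 := hy (z - l) (by omega)
          rw [sub_add_cancel] at e1 e2
          rw [e1, e2]
          exact ih (n - l) (by omega) _ (by omega) (by omega)
    have hLL : ∀ n : ℕ, ∀ z, j' - n ≤ z → x z = y z := by
      intro n
      induction n using Nat.strong_induction_on with
      | _ n ih =>
        intro z h1
        by_cases hz : j' - l' ≤ z
        · exact hR (z - j).toNat z hz (by omega)
        · have e1 := hx' (z + l') (by omega)
          have e2 := hy' (z + l') (by omega)
          rw [add_sub_cancel_right] at e1 e2
          rw [e1, e2]
          exact ih (n - l') (by omega) _ (by omega)
    funext z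
    exact hLL (j' - z).toNat z (by omega)
  refine (Set.countable_iUnion hA).mono ?_
  intro x hx
  obtain ⟨j, l, hj, hl, h⟩ := right_periodic P hP hx
  obtain ⟨j', l', hj', hl', h'⟩ := left_periodic P hP hx
  exact Set.mem_iUnion.2 ⟨((j, l), (j', l')), ⟨hj, hl, h⟩, ⟨hj', hl', h'⟩⟩

end TitsCA


namespace TitsCA

/-! ### Cells, reading and writing data -/

abbrev QQ := Bool × Bool × Bool
abbrev DD := (Bool × Bool) × QQ

def d0 : DD := ((false, false), (false, false, false))

def bit (d : DD) (k : ℕ) : Bool :=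
  if k = 9 then true else if k = 10 then d.1.1 else if k = 11 then d.1.2 else
  if k = 12 then d.2.1 else if k = 13 then d.2.2.1 else if k = 14 then d.2.2.2 else
  if k = 15 then true else false

theorem bit_out (d d' : DD) {k : ℕ} (h : k < 10 ∨ 15 ≤ k) : bit d k = bit d' k := by
  unfold bit
  have h1 : k ≠ 10 := by omega
  have h2 : k ≠ 11 := by omega
  have h3 : k ≠ 12 := by omega
  have h4 : k ≠ 13 := by omega
  have h5 : k ≠ 14 := by omega
  simp [h1, h2, h3, h4, h5]

theorem bit_low (d : DD) {k : ℕ} (h : k < 9) : bit d k = false := by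
  unfold bit
  have h0 : k ≠ 9 := by omega
  have h1 : k ≠ 10 := by omega
  have h2 : k ≠ 11 := by omega
  have h3 : k ≠ 12 := by omega
  have h4 : k ≠ 13 := by omega
  have h5 : k ≠ 14 := by omega
  have h6 : k ≠ 15 := by omega
  simp [h0, h1, h2, h3, h4, h5, h6]

theorem bit_inj {d d' : DD} (h : ∀ k < 25, bit d k = bit d' k) : d = d' := by
  have h1 := h 10 (by norm_num)
  have h2 := h 11 (by norm_num)
  have h3 := h 12 (by norm_num)
  have h4 := h 13 (by norm_num)
  have h5 := h 14 (by norm_num)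
  simp [bit] at h1 h2 h3 h4 h5
  ext <;> assumption

structure Code (Γ : Type) where
  n : ℕ
  u : ℕ → Γ
  v : ℕ → Γ
  e : ℕ
  he : e < n
  hne : u e ≠ v e
  hlt : ∀ i < e, u i = v i

namespace Code

variable {Γ : Type} (c : Code Γ)

def w (b : Bool) (r : ℕ) : Γ := if b then c.v r else c.u r

def Occ (x : ℤ → Γ) (p : ℤ) (d : DD) : Prop :=
  ∀ k < 25, ∀ r < c.n, x (p + (k * c.n + r : ℕ)) = c.w (bit d k) r

def cells (x : ℤ → Γ) : Set ℤ := {p | ∃ d, c.Occ x p d}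

theorem n_pos : 0 < c.n := lt_of_le_of_lt (Nat.zero_le _) c.he

variable {c}

theorem w_inj {b b' : Bool} (h : c.w b c.e = c.w b' c.e) : b = b' := by
  have := c.hne
  cases b <;> cases b' <;> simp_all [w]

theorem Occ.unique {x : ℤ → Γ} {p : ℤ} {d d' : DD} (h : c.Occ x p d) (h' : c.Occ x p d') :
    d = d' := by
  apply bit_inj
  intro k hk
  apply w_inj (c := c)
  rw [← h k hk _ c.he, ← h' k hk _ c.he]

/-- before the first marker, an occurrence is `n`-periodic -/
theorem Occ.periodic {x : ℤ → Γ} {p : ℤ} {d : DD} (h : c.Occ x p d) {i : ℕ}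
    (hi : i + c.n < 9 * c.n + c.e) : x (p + (i + c.n : ℕ)) = x (p + i) := by
  have hn := c.n_pos
  obtain ⟨k, r, hr, rfl⟩ : ∃ k r, r < c.n ∧ i = k * c.n + r :=
    ⟨i / c.n, i % c.n, Nat.mod_lt _ hn, by rw [mul_comm]; exact (Nat.div_add_mod _ _).symm⟩
  have he := c.he
  have hk : k + 1 < 10 := by
    by_contra hcon
    have := Nat.mul_le_mul_right c.n (show 9 ≤ k by omega)
    omega
  have e1 := h k (by omega) r hr
  have e2 := h (k + 1) (by omega) r hr
  rw [show (k + 1) * c.n + r = k * c.n + r + c.n by ring] at e2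
  rw [e1, e2, bit_low d (show k < 9 by omega)]
  by_cases hk9 : k + 1 < 9
  · rw [bit_low d hk9]
  · obtain rfl : k = 8 := by omega
    have : r < c.e := by omega
    simp [bit, w, c.hlt r this]

theorem spacing {x : ℤ → Γ} {p p' : ℤ} (h : p ∈ c.cells x) (h' : p' ∈ c.cells x) (hlt : p < p') :
    p + 15 * c.n ≤ p' := by
  obtain ⟨d, h⟩ := h
  obtain ⟨d', h'⟩ := h'
  by_contra hcon
  have hn := c.n_pos
  have he := c.he
  by_cases hcase : p' - p ≤ 8 * c.n + c.e
  · have e1 := h 8 (by norm_num) c.e he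
    have e2 := h 9 (by norm_num) c.e he
    have e3 := h'.periodic (i := (p + 8 * c.n + c.e - p').toNat) (by omega)
    rw [show p' + ((p + 8 * c.n + c.e - p').toNat : ℕ) = p + (8 * c.n + c.e : ℕ) by omega,
      show p' + ((p + 8 * c.n + c.e - p').toNat + c.n : ℕ) = p + (9 * c.n + c.e : ℕ) by omega,
      e1, e2] at e3
    have := w_inj e3
    simp [bit] at this
  · have e1 := h 15 (by norm_num) c.e he
    have e2 := h 16 (by norm_num) c.e he
    have e3 := h'.periodic (i := (p + 15 * c.n + c.e - p').toNat) (by omega)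
    rw [show p' + ((p + 15 * c.n + c.e - p').toNat : ℕ) = p + (15 * c.n + c.e : ℕ) by omega,
      show p' + ((p + 15 * c.n + c.e - p').toNat + c.n : ℕ) = p + (16 * c.n + c.e : ℕ) by omega,
      e1, e2] at e3
    have := w_inj e3
    simp [bit] at this

variable (c)

open Classical in
noncomputable def read (x : ℤ → Γ) (p : ℤ) : DD :=
  if h : ∃ d, c.Occ x p d then h.choose else d0

/-- `z` lies in the data region of the cell `p` -/
def InV (p z : ℤ) : Prop := p + 10 * c.n ≤ z ∧ z < p + 15 * c.n

open Classical in
noncomputable def write (x : ℤ → Γ) (d : ℤ → DD) (z : ℤ) : Γ :=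
  if h : ∃ p, p ∈ c.cells x ∧ c.InV p z then
    c.w (bit (d h.choose) ((z - h.choose).toNat / c.n)) ((z - h.choose).toNat % c.n)
  else x z

variable {c}

theorem read_eq {x : ℤ → Γ} {p : ℤ} {d : DD} (h : c.Occ x p d) : c.read x p = d := by
  unfold read
  have : ∃ d, c.Occ x p d := ⟨d, h⟩
  rw [dif_pos this]
  exact this.choose_spec.unique h

theorem occ_read {x : ℤ → Γ} {p : ℤ} (h : p ∈ c.cells x) : c.Occ x p (c.read x p) := by
  obtain ⟨d, hd⟩ := h
  rw [read_eq hd]; exact hd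

theorem read_out {x : ℤ → Γ} {p : ℤ} (h : p ∉ c.cells x) : c.read x p = d0 := by
  have h' : ¬ ∃ d, c.Occ x p d := h
  unfold read
  rw [dif_neg h']

theorem inV_unique {x : ℤ → Γ} {p p' z : ℤ} (h : p ∈ c.cells x) (h' : p' ∈ c.cells x)
    (hz : c.InV p z) (hz' : c.InV p' z) : p = p' := by
  obtain ⟨h1, h2⟩ := hz
  obtain ⟨h3, h4⟩ := hz'
  rcases lt_trichotomy p p' with hlt | heq | hlt
  · have := spacing h h' hlt; omega
  · exact heq
  · have := spacing h' h hlt; omega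

theorem write_in {x : ℤ → Γ} {d : ℤ → DD} {p z : ℤ} (hp : p ∈ c.cells x) (hz : c.InV p z) :
    c.write x d z = c.w (bit (d p) ((z - p).toNat / c.n)) ((z - p).toNat % c.n) := by
  unfold write
  have h : ∃ p, p ∈ c.cells x ∧ c.InV p z := ⟨p, hp, hz⟩
  rw [dif_pos h]
  have : h.choose = p := inV_unique h.choose_spec.1 hp h.choose_spec.2 hz
  rw [this]

theorem write_out {x : ℤ → Γ} {d : ℤ → DD} {z : ℤ} (h : ∀ p ∈ c.cells x, ¬ c.InV p z) :
    c.write x d z = x z := by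
  unfold write
  rw [dif_neg]
  rintro ⟨p, hp, hz⟩
  exact h p hp hz

theorem write_block {x : ℤ → Γ} {d : ℤ → DD} {p : ℤ} (hp : p ∈ c.cells x) {k r : ℕ}
    (hk : 10 ≤ k) (hk' : k < 15) (hr : r < c.n) :
    c.write x d (p + (k * c.n + r : ℕ)) = c.w (bit (d p) k) r := by
  have hn := c.n_pos
  have h1 := Nat.mul_le_mul_right c.n hk
  have h2 := Nat.mul_le_mul_right c.n (show k + 1 ≤ 15 by omega)
  rw [Nat.add_mul] at h2
  rw [write_in hp ⟨by omega, by omega⟩]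
  have : (p + ((k * c.n + r : ℕ) : ℤ) - p).toNat = r + c.n * k := by
    rw [add_sub_cancel_left, Int.toNat_natCast]; ring
  rw [this, Nat.add_mul_div_left _ _ hn, Nat.add_mul_mod_self_left, Nat.div_eq_of_lt hr,
    Nat.mod_eq_of_lt hr, zero_add]

theorem occ_write {x : ℤ → Γ} (d : ℤ → DD) {p : ℤ} (hp : p ∈ c.cells x) :
    c.Occ (c.write x d) p (d p) := by
  intro k hk r hr
  by_cases h : 10 ≤ k ∧ k < 15
  · exact write_block hp h.1 h.2 hr
  · have hx := occ_read hp k hk r hr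
    rw [write_out, hx, bit_out _ (d p) (by omega)]
    rintro p' hp' ⟨h1, h2⟩
    have h25 := Nat.mul_le_mul_right c.n (show k + 1 ≤ 25 by omega)
    rw [Nat.add_mul] at h25
    rcases lt_trichotomy p p' with hlt | rfl | hlt
    · have := spacing hp hp' hlt; omega
    · rcases lt_or_ge k 10 with h' | h'
      · have := Nat.mul_le_mul_right c.n (show k + 1 ≤ 10 by omega)
        rw [Nat.add_mul] at this
        omega
      · have := Nat.mul_le_mul_right c.n (show 15 ≤ k by omega)
        omega
    · have := spacing hp' hp hlt; omega

theorem cells_congr {x y : ℤ → Γ} {p : ℤ} (h : ∀ z, p ≤ z → z < p + 25 * c.n → x z = y z)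
    {d : DD} : c.Occ x p d ↔ c.Occ y p d := by
  unfold Occ
  refine forall_congr' fun k => forall_congr' fun hk => forall_congr' fun r =>
    forall_congr' fun hr => ?_
  have h25 := Nat.mul_le_mul_right c.n (show k + 1 ≤ 25 by omega)
  rw [Nat.add_mul] at h25
  rw [h _ (by omega) (by omega)]

@[simp] theorem cells_write (x : ℤ → Γ) (d : ℤ → DD) : c.cells (c.write x d) = c.cells x := by
  have hsub : ∀ p, p ∈ c.cells x → p ∈ c.cells (c.write x d) := fun p hp => ⟨_, occ_write d hp⟩
  ext p
  refine ⟨fun hp => ?_, hsub p⟩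
  by_contra hcon
  obtain ⟨d', hd'⟩ := hp
  apply hcon
  refine ⟨d', (cells_congr ?_).1 hd'⟩
  intro z h1 h2
  apply write_out
  rintro p' hp' ⟨h3, h4⟩
  rcases lt_trichotomy p p' with hlt | rfl | hlt
  · have := spacing ⟨d', hd'⟩ (hsub _ hp') hlt; omega
  · exact hcon hp'
  · have := spacing (hsub _ hp') ⟨d', hd'⟩ hlt; omega

theorem read_write {x : ℤ → Γ} (d : ℤ → DD) {p : ℤ} (hp : p ∈ c.cells x) :
    c.read (c.write x d) p = d p := read_eq (occ_write d hp)

theorem write_congr {x : ℤ → Γ} {d d' : ℤ → DD} (h : ∀ p ∈ c.cells x, d p = d' p) :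
    c.write x d = c.write x d' := by
  funext z
  by_cases hz : ∃ p, p ∈ c.cells x ∧ c.InV p z
  · obtain ⟨p, hp, hz⟩ := hz
    rw [write_in hp hz, write_in hp hz, h p hp]
  · push Not at hz
    rw [write_out hz, write_out hz]

theorem write_write (x : ℤ → Γ) (d d' : ℤ → DD) : c.write (c.write x d) d' = c.write x d' := by
  funext z
  by_cases hz : ∃ p, p ∈ c.cells x ∧ c.InV p z
  · obtain ⟨p, hp, hz⟩ := hz
    rw [write_in hp hz, write_in (by simpa using hp) hz]
  · push Not at hz
    rw [write_out hz, write_out (by simpa using hz), write_out hz]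

theorem write_read (x : ℤ → Γ) : c.write x (c.read x) = x := by
  funext z
  by_cases hz : ∃ p, p ∈ c.cells x ∧ c.InV p z
  · obtain ⟨p, hp, hz⟩ := hz
    rw [write_in hp hz]
    have hn := c.n_pos
    have := occ_read hp ((z - p).toNat / c.n) (by
      rw [Nat.div_lt_iff_lt_mul hn]
      have := hz.2
      omega) ((z - p).toNat % c.n) (Nat.mod_lt _ hn)
    rw [← this, Nat.div_add_mod']
    congr 1
    have := hz.1
    omega
  · push Not at hz
    rw [write_out hz]

/-- locality of writing -/
theorem write_local {x y : ℤ → Γ} {d d' : ℤ → DD} {z : ℤ} (h0 : x z = y z)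
    (h1 : ∀ p, z - 15 * c.n ≤ p → p ≤ z → (p ∈ c.cells x ↔ p ∈ c.cells y))
    (h2 : ∀ p, z - 15 * c.n ≤ p → p ≤ z → d p = d' p) : c.write x d z = c.write y d' z := by
  by_cases hz : ∃ p, p ∈ c.cells x ∧ c.InV p z
  · obtain ⟨p, hp, hz⟩ := hz
    have h3 := hz.1
    have h4 := hz.2
    rw [write_in hp hz, write_in ((h1 p (by omega) (by omega)).1 hp) hz,
      h2 p (by omega) (by omega)]
  · push Not at hz
    rw [write_out hz, write_out, h0]
    intro p hp hzp
    have h3 := hzp.1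
    have h4 := hzp.2
    exact hz p ((h1 p (by omega) (by omega)).2 hp) hzp

theorem read_congr {x y : ℤ → Γ} {p q : ℤ} (h : ∀ d, c.Occ x p d ↔ c.Occ y q d) :
    c.read x p = c.read y q := by
  by_cases hp : p ∈ c.cells x
  · obtain ⟨d, hd⟩ := hp
    rw [read_eq hd, read_eq ((h d).1 hd)]
  · rw [read_out hp, read_out]
    rintro ⟨d, hd⟩
    exact hp ⟨d, (h d).2 hd⟩

/-! shift equivariance -/

theorem occ_shift {x : ℤ → Γ} {p : ℤ} {d : DD} :
    c.Occ (fun i => x (i + 1)) p d ↔ c.Occ x (p + 1) d := by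
  unfold Occ
  refine forall_congr' fun k => forall_congr' fun hk => forall_congr' fun r =>
    forall_congr' fun hr => ?_
  show x (_ + 1) = _ ↔ _
  rw [show p + ((k * c.n + r : ℕ) : ℤ) + 1 = p + 1 + ((k * c.n + r : ℕ) : ℤ) by ring]

theorem cells_shift {x : ℤ → Γ} {p : ℤ} :
    p ∈ c.cells (fun i => x (i + 1)) ↔ p + 1 ∈ c.cells x :=
  exists_congr fun _ => occ_shift

theorem read_shift {x : ℤ → Γ} {p : ℤ} :
    c.read (fun i => x (i + 1)) p = c.read x (p + 1) :=
  read_congr fun _ => occ_shift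

theorem write_shift {x : ℤ → Γ} {d : ℤ → DD} :
    c.write (fun i => x (i + 1)) (fun p => d (p + 1)) = fun i => c.write x d (i + 1) := by
  funext z
  by_cases hz : ∃ p, p ∈ c.cells x ∧ c.InV p (z + 1)
  · obtain ⟨p, hp, hz⟩ := hz
    rw [write_in hp hz, write_in (p := p - 1) (cells_shift.2 (by simpa using hp))
      ⟨by have := hz.1; omega, by have := hz.2; omega⟩]
    simp only [sub_add_cancel]
    rw [show z - (p - 1) = z + 1 - p by ring]
  · push Not at hz
    rw [write_out hz, write_out]
    intro p hp hzp
    exact hz (p + 1) (cells_shift.1 hp) ⟨by have := hzp.1; omega, by have := hzp.2; omega⟩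

/-! ### writing stays in the subshift -/

variable (c)

def wl (b : Bool) : List Γ := (List.range c.n).map (c.w b)

variable {c}

theorem profile_blocks {F : Type} {L : Language Γ} (P : Profile L F)
    (hP : P.toFun (c.wl false) = P.toFun (c.wl true)) {x : ℤ → Γ} (m : ℕ) (a : ℤ)
    (h : ∀ k < m, ∃ b, word x (a + (k * c.n : ℕ)) c.n = c.wl b) :
    P.toFun (word x a (m * c.n)) = P.toFun (rep (c.wl false) m) := by
  induction m generalizing a with
  | zero => simp [word, rep]
  | succ m ih =>
    rw [show (m + 1) * c.n = c.n + m * c.n by ring, word_add]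
    apply P.congr
    · obtain ⟨b, hb⟩ := h 0 (by omega)
      simp only [zero_mul, Nat.cast_zero, add_zero] at hb
      rw [hb]
      cases b
      · rfl
      · exact hP.symm
    · apply ih
      intro k hk
      obtain ⟨b, hb⟩ := h (k + 1) (by omega)
      refine ⟨b, ?_⟩
      rw [← hb]
      congr 1
      push_cast
      ring

theorem word_block {x : ℤ → Γ} {a : ℤ} {b : Bool} (h : ∀ r < c.n, x (a + r) = c.w b r) :
    word x a c.n = c.wl b := by
  apply List.map_congr_left
  intro r hr
  exact h r (List.mem_range.1 hr)

theorem write_mem {F : Type} {L : Language Γ} (P : Profile L F)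
    (hP : P.toFun (c.wl false) = P.toFun (c.wl true)) {x : ℤ → Γ} (hx : x ∈ SX L)
    (d : ℤ → DD) : c.write x d ∈ SX L := by
  have hn := c.n_pos
  -- positions which are not strictly inside a data region
  let G : ℤ → Prop := fun a => ∀ p ∈ c.cells x, a ≤ p + 10 * c.n ∨ p + 15 * c.n ≤ a
  have hV : ∀ (y : ℤ → Γ) p d', c.Occ y p d' →
      P.toFun (word y (p + 10 * c.n) (5 * c.n)) = P.toFun (rep (c.wl false) 5) := by
    intro y p d' hy
    apply profile_blocks P hP
    intro k hk
    refine ⟨bit d' (10 + k), word_block ?_⟩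
    intro r hr
    rw [← hy (10 + k) (by omega) r hr]
    congr 1
    push_cast
    ring
  have key : ∀ (k : ℕ) (a : ℤ), G a → G (a + k) →
      P.toFun (word (c.write x d) a k) = P.toFun (word x a k) := by
    intro k
    induction k using Nat.strong_induction_on with
    | _ k ih =>
      intro a ha hak
      by_cases hk : k = 0
      · subst hk; simp [word]
      by_cases hs : ∃ p ∈ c.cells x, a = p + 10 * c.n
      · obtain ⟨p, hp, rfl⟩ := hs
        have h5 : 5 * c.n ≤ k := by
          rcases hak p hp with h | h <;> omega
        obtain ⟨l, rfl⟩ := Nat.exists_eq_add_of_le h5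
        rw [word_add, word_add]
        apply P.congr
        · rw [hV _ p _ (occ_write d hp), hV _ p _ (occ_read hp)]
        · apply ih l (by omega)
          · intro p' hp'
            rcases lt_trichotomy p p' with hlt | rfl | hlt
            · have := spacing hp hp' hlt; push_cast; omega
            · right; push_cast; omega
            · have := spacing hp' hp hlt; push_cast; omega
          · intro p' hp'
            have := hak p' hp'
            push_cast at this ⊢
            omega
      · push Not at hs
        obtain ⟨l, rfl⟩ : ∃ l, k = 1 + l := ⟨k - 1, by omega⟩
        rw [word_add, word_add]
        apply P.congr
        · congr 1
          apply word_congr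
          intro t ht
          obtain rfl : t = 0 := by omega
          apply write_out
          rintro p hp ⟨h1, h2⟩
          have := hs p hp
          rcases ha p hp with h | h <;> simp at h1 h2 <;> omega
        · apply ih l (by omega)
          · intro p hp
            have := hs p hp
            rcases ha p hp with h | h <;> push_cast <;> omega
          · have := hak
            push_cast at this ⊢
            rwa [add_assoc]
  have hlow : ∀ i, ∃ a ≤ i, G a := by
    intro i
    by_cases hi : G i
    · exact ⟨i, le_rfl, hi⟩
    · simp only [G] at hi
      push Not at hi
      obtain ⟨p, hp, h1, h2⟩ := hi
      refine ⟨p + 10 * c.n, by omega, ?_⟩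
      intro p' hp'
      rcases lt_trichotomy p p' with hlt | rfl | hlt
      · have := spacing hp hp' hlt; omega
      · omega
      · have := spacing hp' hp hlt; omega
  have hhigh : ∀ i, ∃ a, i ≤ a ∧ G a := by
    intro i
    by_cases hi : G i
    · exact ⟨i, le_rfl, hi⟩
    · simp only [G] at hi
      push Not at hi
      obtain ⟨p, hp, h1, h2⟩ := hi
      refine ⟨p + 15 * c.n, by omega, ?_⟩
      intro p' hp'
      rcases lt_trichotomy p p' with hlt | rfl | hlt
      · have := spacing hp hp' hlt; omega
      · omega
      · have := spacing hp' hp hlt; omega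
  intro i k hbad
  obtain ⟨a, hai, ha⟩ := hlow i
  obtain ⟨b, hib, hb⟩ := hhigh (i + k)
  have hw : word (c.write x d) a (b - a).toNat = word (c.write x d) a (i - a).toNat ++
      word (c.write x d) i k ++ word (c.write x d) (i + k) (b - (i + k)).toNat := by
    rw [show (b - a).toNat = (i - a).toNat + k + (b - (i + k)).toNat by omega, word_add, word_add]
    rw [show a + ((i - a).toNat : ℤ) = i by omega,
      show a + (((i - a).toNat + k : ℕ) : ℤ) = i + k by omega]
  have hbad' := hbad.mono (word (c.write x d) a (i - a).toNat)
    (word (c.write x d) (i + k) (b - (i + k)).toNat)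
  rw [← hw] at hbad'
  have := P.bad _ _ (key _ a ha (by rwa [show a + ((b - a).toNat : ℤ) = b by omega])) hbad'
  exact hx _ _ this

/-- the periodic point with cells at all multiples of `16 n` -/
theorem exists_base {F : Type} {L : Language Γ} (P : Profile L F)
    (hP : P.toFun (c.wl false) = P.toFun (c.wl true)) (hk : ∀ k, ¬ Bad L (rep (c.wl false) k)) :
    ∃ x ∈ SX L, ∀ i : ℤ, i * (16 * c.n) ∈ c.cells x := by
  have hn := c.n_pos
  let x : ℤ → Γ := fun z => c.w (bit d0 ((z / c.n) % 16).toNat) (z % c.n).toNat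
  have hx : ∀ (j : ℤ) (r : ℕ), r < c.n → x (j * c.n + r) = c.w (bit d0 (j % 16).toNat) r := by
    intro j r hr
    simp only [x]
    have h1 : (j * c.n + r) / (c.n : ℤ) = j := by
      rw [add_comm, Int.add_mul_ediv_right _ _ (by omega), Int.ediv_eq_zero_of_lt (by omega)
        (by omega), zero_add]
    have h2 : (j * c.n + r) % (c.n : ℤ) = r := by
      rw [add_comm, Int.add_mul_emod_self_right, Int.emod_eq_of_lt (by omega) (by omega)]
    rw [h1, h2, Int.toNat_natCast]
  refine ⟨x, ?_, ?_⟩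
  · intro i k hbad
    have h1 : (i / c.n) * c.n ≤ i := Int.ediv_mul_le _ (by omega)
    set a := i / (c.n : ℤ)
    have h2 : i + k ≤ a * c.n + ((i - a * c.n).toNat + k : ℕ) * c.n := by
      have : ((i - a * c.n).toNat + k : ℕ) ≤ ((i - a * c.n).toNat + k : ℕ) * c.n :=
        Nat.le_mul_of_pos_right _ hn
      zify at this
      rw [Int.toNat_of_nonneg (by omega)] at this
      push_cast
      rw [Int.toNat_of_nonneg (by omega)]
      linarith
    set m := (i - a * c.n).toNat + k
    have hprof := profile_blocks P hP (x := x) m (a * c.n) (by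
      intro k hk
      refine ⟨_, word_block (b := bit d0 ((a + k) % 16).toNat) ?_⟩
      intro r hr
      rw [← hx _ r hr]
      congr 1
      push_cast
      ring)
    obtain ⟨q, hq⟩ : ∃ q : ℕ, m * c.n = (i - a * c.n).toNat + k + q := by
      apply Nat.exists_eq_add_of_le
      zify
      rw [Int.toNat_of_nonneg (by omega)]
      linarith
    rw [hq, word_add, word_add] at hprof
    rw [show a * c.n + ((i - a * c.n).toNat : ℤ) = i by omega] at hprof
    exact hk m (P.bad _ _ hprof (hbad.mono _ _))
  · intro i
    refine ⟨d0, ?_⟩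
    intro k hk r hr
    have := hx (i * 16 + k) r hr
    rw [show i * (16 * (c.n : ℤ)) + ((k * c.n + r : ℕ) : ℤ) = (i * 16 + k) * c.n + r by
      push_cast; ring, this]
    congr 1
    have h3 : ((i * 16 + k) % 16).toNat = k % 16 := by omega
    rw [h3]
    by_cases hk16 : k < 16
    · rw [Nat.mod_eq_of_lt hk16]
    · rw [bit_low _ (by omega)]
      unfold bit
      simp [show k ≠ 9 by omega, show k ≠ 15 by omega, d0]

end Code

/-- extract a code from branching words -/
theorem exists_code {Γ F : Type} {L : Language Γ} (P : Profile L F) (h : Branch P) :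
    ∃ c : Code Γ, P.toFun (c.wl false) = P.toFun (c.wl true) ∧
      ∀ k, ¬ Bad L (rep (c.wl false) k) := by
  obtain ⟨u, v, hne, hlen, hP, hk⟩ := h
  have hex : ∃ i : ℕ, u[i]? ≠ v[i]? := by
    by_contra hcon
    push Not at hcon
    exact hne (List.ext_getElem? hcon)
  classical
  have hu0 : u ≠ [] := by
    rintro rfl
    exact hne (List.length_eq_zero_iff.1 hlen.symm).symm
  let g : Γ := u.head hu0
  have hwl : ∀ l : List Γ, (List.range l.length).map (fun i => l.getD i g) = l := by
    intro l
    apply List.ext_getElem (by simp)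
    intro i h1 h2
    simp [List.getElem?_eq_getElem h2]
  have hlt : Nat.find hex < u.length := by
    by_contra hcon
    apply Nat.find_spec hex
    rw [List.getElem?_eq_none (by omega), List.getElem?_eq_none (by omega)]
  refine ⟨⟨u.length, fun i => u.getD i g, fun i => v.getD i g, Nat.find hex, hlt, ?_, ?_⟩, ?_, ?_⟩
  · intro heq
    apply Nat.find_spec hex
    rw [List.getD_eq_getElem _ _ hlt, List.getD_eq_getElem _ _ (hlen ▸ hlt)] at heq
    rw [List.getElem?_eq_getElem hlt, List.getElem?_eq_getElem (hlen ▸ hlt), heq]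
  · intro i hi
    have := Nat.find_min hex hi
    push Not at this
    simp only [List.getD_eq_getElem?_getD, this]
  · have h1 := hwl u
    have h2 := hwl v
    rw [← hlen] at h2
    have e1 : ∀ c : Code Γ, c.wl false = (List.range c.n).map (fun i => c.u i) := fun c => rfl
    have e2 : ∀ c : Code Γ, c.wl true = (List.range c.n).map (fun i => c.v i) := fun c => rfl
    rw [e1, e2]
    simp only
    rw [h1, h2, hP]
  · have h1 := hwl u
    have e1 : ∀ c : Code Γ, c.wl false = (List.range c.n).map (fun i => c.u i) := fun c => rfl
    rw [e1]
    simp only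
    rw [h1]
    exact hk

end TitsCA


namespace TitsCA

open scoped commutatorElement

/-! ### Group theory -/

theorem dihedral_sq {G : Type*} [Group G] {a b : G} (ha : a * a = 1) (hb : b * b = 1) {g : G}
    (hg : g ∈ Subgroup.closure {a, b}) : ∃ m : ℤ, g * g = (a * b) ^ m := by
  have ha' : a⁻¹ = a := inv_eq_of_mul_eq_one_left ha
  have hb' : b⁻¹ = b := inv_eq_of_mul_eq_one_left hb
  have hconj : ∀ k : ℤ, a * (a * b) ^ k * a = (a * b) ^ (-k) := by
    intro k
    have h1 : a * (a * b) ^ k * a⁻¹ = (a * (a * b) * a⁻¹) ^ k := (conj_zpow).symm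
    have h2 : a * (a * b) * a⁻¹ = (a * b)⁻¹ := by
      rw [mul_inv_rev, hb', ha', ← mul_assoc, ha, one_mul]
    rw [h2, inv_zpow', ha'] at h1
    exact h1
  have hleft : ∀ k : ℤ, a * (a * b) ^ k = (a * b) ^ (-k) * a := by
    intro k
    rw [← hconj k, mul_assoc, ha, mul_one]
  have hba : b = (a * b) ^ (-1 : ℤ) * a := by
    rw [zpow_neg_one, mul_inv_rev, ha', hb', mul_assoc, ha, mul_one]
  have key : ∃ k : ℤ, g = (a * b) ^ k ∨ g = (a * b) ^ k * a := by
    have step : ∀ x ∈ ({a, b} : Set G), ∀ y : G, (∃ k : ℤ, y = (a * b) ^ k ∨ y = (a * b) ^ k * a) →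
        ∃ k : ℤ, x * y = (a * b) ^ k ∨ x * y = (a * b) ^ k * a := by
      have hA : ∀ y : G, (∃ k : ℤ, y = (a * b) ^ k ∨ y = (a * b) ^ k * a) →
        ∃ k : ℤ, a * y = (a * b) ^ k ∨ a * y = (a * b) ^ k * a := by
        rintro y ⟨k, rfl | rfl⟩
        · exact ⟨-k, Or.inr (hleft k)⟩
        · refine ⟨-k, Or.inl ?_⟩
          rw [← mul_assoc, hconj]
      rintro x (rfl | rfl) y hy
      · exact hA y hy
      · obtain ⟨k, hk | hk⟩ := hA y hy
        · refine ⟨-1 + k, Or.inl ?_⟩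
          rw [zpow_add, ← hk, ← mul_assoc, ← hba]
        · refine ⟨-1 + k, Or.inr ?_⟩
          rw [zpow_add, mul_assoc, ← hk, ← mul_assoc, ← hba]
    induction hg using Subgroup.closure_induction_left with
    | one => exact ⟨0, Or.inl (by simp)⟩
    | mul_left x hx y _ ih => exact step x hx y ih
    | inv_mul_cancel x hx y _ ih =>
      have hx' : x⁻¹ = x := by
        rcases hx with rfl | rfl
        · exact ha'
        · exact hb'
      rw [hx']
      exact step x hx y ih
  obtain ⟨k, rfl | rfl⟩ := key
  · exact ⟨k + k, by rw [zpow_add]⟩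
  · refine ⟨0, ?_⟩
    rw [mul_assoc, ← mul_assoc a, hconj, ← zpow_add, add_neg_cancel]

theorem comm_mem {G : Type*} [Group G] {a b : G} (ha : a * a = 1) (hb : b * b = 1)
    (N : Subgroup G) (hNa : ∀ n ∈ N, a * n * a ∈ N) (hNb : ∀ n ∈ N, b * n * b ∈ N)
    {S : Set G} (hS : S ⊆ N) {g h : G} (hg : g ∈ Subgroup.closure ({a, b} ∪ S))
    (hh : h ∈ Subgroup.closure ({a, b} ∪ S)) : ⁅g * g, h * h⁆ ∈ N := by
  have ha' : a⁻¹ = a := inv_eq_of_mul_eq_one_left ha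
  have hb' : b⁻¹ = b := inv_eq_of_mul_eq_one_left hb
  let Z : Subgroup G := Subgroup.normalizer (N : Set G)
  have hnorm : ∀ t : G, t⁻¹ = t → (∀ n ∈ N, t * n * t ∈ N) → t ∈ Z := by
    intro t ht h
    refine Subgroup.mem_normalizer_iff.2 fun n => ⟨fun hn => ?_, fun hn => ?_⟩
    · rw [ht]; exact h n hn
    · have := h _ hn
      rw [ht] at this
      have h3 : t * t = 1 := by nth_rw 1 [← ht]; exact inv_mul_cancel t
      have h4 : t * (t * n * t) * t = n := by
        calc t * (t * n * t) * t = (t * t) * n * (t * t) := by group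
          _ = n := by rw [h3]; group
      rwa [h4] at this
  have haZ : a ∈ Z := hnorm a ha' hNa
  have hbZ : b ∈ Z := hnorm b hb' hNb
  have hSZ : ∀ s ∈ S, s ∈ Z := fun s hs => Subgroup.le_normalizer (hS hs)
  let N' : Subgroup Z := N.subgroupOf Z
  have : N'.Normal := Subgroup.normal_in_normalizer
  let q : Z →* Z ⧸ N' := QuotientGroup.mk' N'
  let a1 : Z := ⟨a, haZ⟩
  let b1 : Z := ⟨b, hbZ⟩
  have hle : Subgroup.closure ({a, b} ∪ S) ≤
      ((Subgroup.closure {q a1, q b1}).comap q).map Z.subtype := by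
    rw [Subgroup.closure_le]
    rintro t ((rfl | rfl) | ht)
    · exact ⟨a1, Subgroup.subset_closure (by simp), rfl⟩
    · exact ⟨b1, Subgroup.subset_closure (by simp), rfl⟩
    · refine ⟨⟨t, hSZ t ht⟩, ?_, rfl⟩
      have : q ⟨t, hSZ t ht⟩ = 1 := (QuotientGroup.eq_one_iff _).2 (hS ht)
      rw [SetLike.mem_coe, Subgroup.mem_comap, this]
      exact one_mem _
  obtain ⟨g, hg1, rfl⟩ := hle hg
  obtain ⟨h, hh1, rfl⟩ := hle hh
  have ha1 : q a1 * q a1 = 1 := by rw [← map_mul, ← map_one q]; congr 1; exact Subtype.ext ha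
  have hb1 : q b1 * q b1 = 1 := by rw [← map_mul, ← map_one q]; congr 1; exact Subtype.ext hb
  obtain ⟨m, hm⟩ := dihedral_sq ha1 hb1 hg1
  obtain ⟨l, hl⟩ := dihedral_sq ha1 hb1 hh1
  have : q ⁅g * g, h * h⁆ = 1 := by
    rw [map_commutatorElement, map_mul, map_mul, hm, hl, commutatorElement_eq_one_iff_mul_comm,
      ← zpow_add, ← zpow_add, add_comm]
  exact (QuotientGroup.eq_one_iff (N := N') _).1 this

theorem free_comm_ne : ⁅(FreeGroup.of (0 : Fin 2)) * FreeGroup.of 0,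
    FreeGroup.of (1 : Fin 2) * FreeGroup.of 1⁆ ≠ 1 := by
  intro h
  have := congrArg (FreeGroup.lift (fun i : Fin 2 =>
    if i = 0 then (Equiv.swap 0 1 * Equiv.swap 1 2 : Equiv.Perm (Fin 4))
    else Equiv.swap 1 2 * Equiv.swap 2 3)) h
  rw [map_commutatorElement, map_mul, map_mul, FreeGroup.lift_apply_of, FreeGroup.lift_apply_of,
    map_one] at this
  revert this
  decide

theorem no_free {G : Type*} [Group G] {a b : G} (ha : a * a = 1) (hb : b * b = 1)
    (N : Subgroup G) (hNa : ∀ n ∈ N, a * n * a ∈ N) (hNb : ∀ n ∈ N, b * n * b ∈ N)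
    {e : ℕ} (he : e ≠ 0) (hN : ∀ n ∈ N, n ^ e = 1)
    {S : Set G} (hS : S ⊆ N) (K : Subgroup (Subgroup.closure ({a, b} ∪ S))) :
    ¬ Nonempty (K ≃* FreeGroup (Fin 2)) := by
  rintro ⟨φ⟩
  let X := φ.symm (FreeGroup.of 0)
  let Y := φ.symm (FreeGroup.of 1)
  have h1 : (⁅X * X, Y * Y⁆ : K) ^ e = 1 := by
    apply Subtype.ext
    apply Subtype.ext
    have := hN _ (comm_mem ha hb N hNa hNb hS X.1.2 Y.1.2)
    simpa [commutatorElement_def] using this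
  have h2 := congrArg φ h1
  rw [map_pow, map_commutatorElement, map_mul, map_mul, map_one] at h2
  simp only [X, Y, MulEquiv.apply_symm_apply] at h2
  exact free_comm_ne ((pow_eq_one_iff_left he).1 h2)

theorem not_virtually_solvable {G Q : Type*} [Group G] (hQ : 5 ≤ Cardinal.mk Q)
    (H : Subgroup G) (ρ : G) (hρ : ρ ∈ H) (σ : Equiv.Perm Q → G) (hσ : ∀ g, σ g ∈ H)
    (R : Subgroup (G × Equiv.Perm Q)) (hR : ∀ s, ((1 : G), s) ∈ R → s = 1)
    (h1 : ∀ g, (σ g, g) ∈ R)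
    (h2 : ∀ g, ∀ r : ℕ, 0 < r → (ρ ^ r * σ g * (ρ ^ r)⁻¹, (1 : Equiv.Perm Q)) ∈ R) :
    ¬ ∃ K : Subgroup H, K.FiniteIndex ∧ Group.IsSolvable K := by
  rintro ⟨K, hK, hsol⟩
  let C := K.normalCore
  have hCK : C ≤ K := K.normalCore_le
  have : Group.IsSolvable C := Group.isSolvable_of_isSolvable_injective (Subgroup.inclusion_injective hCK)
  have hCfin : C.FiniteIndex := inferInstance
  obtain ⟨r, hr0, -, hr⟩ := Subgroup.exists_pow_mem_of_index_ne_zero hCfin.index_ne_zero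
    (⟨ρ, hρ⟩ : H)
  let f : C × Equiv.Perm Q →* G × Equiv.Perm Q :=
    MonoidHom.prodMap (H.subtype.comp C.subtype) (MonoidHom.id _)
  let R' : Subgroup (C × Equiv.Perm Q) := R.comap f
  have hinj : Function.Injective ((MonoidHom.fst C (Equiv.Perm Q)).comp R'.subtype) := by
    rw [injective_iff_map_eq_one]
    rintro ⟨⟨k, s⟩, hks⟩ hk
    have hk' : k = 1 := hk
    subst hk'
    have : s = 1 := hR s (by simpa [R', f] using hks)
    subst this
    rfl
  have : Group.IsSolvable R' := Group.isSolvable_of_isSolvable_injective hinj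
  let sn := (MonoidHom.snd C (Equiv.Perm Q)).comp R'.subtype
  have : Group.IsSolvable sn.range := Group.isSolvable_of_surjective sn.rangeRestrict_surjective
  have hcomm : commutator (Equiv.Perm Q) ≤ sn.range := by
    rw [commutator_def, Subgroup.commutator_le]
    intro g _ h _
    have aux : ∀ x y : H, x ∈ C → x * y * x⁻¹ * y⁻¹ ∈ C := by
      intro x y hx
      have := C.mul_mem hx (K.normalCore_normal.conj_mem _ (C.inv_mem hx) y)
      simpa only [mul_assoc] using this
    let kg : H := ⟨ρ, hρ⟩ ^ r * ⟨σ g⁻¹, hσ _⟩ * (⟨ρ, hρ⟩ ^ r)⁻¹ * (⟨σ g⁻¹, hσ _⟩)⁻¹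
    have hkg : kg ∈ C := aux _ _ hr
    let l : H := ⁅kg, ⟨σ h, hσ h⟩⁆
    have hl : l ∈ C := aux _ _ hkg
    have hkR : ((kg : G), g) ∈ R := by
      have := R.mul_mem (h2 g⁻¹ r hr0) (R.inv_mem (h1 g⁻¹))
      simpa [kg] using this
    have hlR : ((l : G), ⁅g, h⁆) ∈ R := by
      have := R.mul_mem (R.mul_mem (R.mul_mem hkR (h1 h)) (R.inv_mem hkR)) (R.inv_mem (h1 h))
      simpa [l, commutatorElement_def] using this
    exact ⟨⟨(⟨l, hl⟩, ⁅g, h⁆), hlR⟩, rfl⟩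
  have : Group.IsSolvable (Equiv.Perm Q) := by
    apply Group.isSolvable_of_ker_le_range sn.range.subtype (Abelianization.of (G := Equiv.Perm Q))
    rw [Abelianization.ker_of, Subgroup.range_subtype]
    exact hcomm
  exact Equiv.Perm.not_isSolvable Q hQ this

end TitsCA

namespace TitsCA

theorem inv_apply_self' {α : Type*} (f : Equiv.Perm α) (x : α) : f⁻¹ (f x) = x :=
  f.symm_apply_apply x

theorem apply_inv_self' {α : Type*} (f : Equiv.Perm α) (x : α) : f (f⁻¹ x) = x :=
  f.apply_symm_apply x

/-! ### Automorphisms from rules -/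

structure Rule (n : ℕ) where
  f : Set ℤ → (ℤ → DD) → ℤ → DD
  norm : ∀ s d p, p ∉ s → d p = d0 → f s d p = d0
  shift : ∀ s d p, f {q | q + 1 ∈ s} (fun q => d (q + 1)) p = f s d (p + 1)
  loc : ∀ s s' d d' p, (∀ q : ℤ, p - 16 * n ≤ q → q ≤ p + 16 * n → ((q ∈ s ↔ q ∈ s') ∧ d q = d' q)) →
    f s d p = f s' d' p

def Rule.Undo {n : ℕ} (R R' : Rule n) : Prop :=
  ∀ s d, (∀ p, p ∉ s → d p = d0) → R'.f s (R.f s d) = d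

namespace Code

variable {Γ : Type} {c : Code Γ}

noncomputable def ap (c : Code Γ) (R : Rule c.n) (x : ℤ → Γ) : ℤ → Γ :=
  c.write x (R.f (c.cells x) (c.read x))

theorem cells_ap (R : Rule c.n) (x : ℤ → Γ) : c.cells (c.ap R x) = c.cells x := by
  simp [ap]

theorem read_ap (R : Rule c.n) (x : ℤ → Γ) :
    c.read (c.ap R x) = R.f (c.cells x) (c.read x) := by
  funext p
  by_cases hp : p ∈ c.cells x
  · exact read_write _ hp
  · rw [read_out (by rwa [cells_ap]), R.norm _ _ _ hp (read_out hp)]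

theorem ap_undo {R R' : Rule c.n} (h : R.Undo R') (x : ℤ → Γ) : c.ap R' (c.ap R x) = x := by
  have h1 : c.ap R' (c.ap R x) = c.write x (R'.f (c.cells x) (R.f (c.cells x) (c.read x))) := by
    conv_lhs => rw [ap, cells_ap, read_ap, ap, write_write]
  rw [h1, h _ _ (fun p hp => read_out hp), write_read]

theorem ap_shift (R : Rule c.n) (x : ℤ → Γ) :
    c.ap R (fun i => x (i + 1)) = fun i => c.ap R x (i + 1) := by
  unfold ap
  rw [← write_shift]
  congr 1
  funext p
  rw [← R.shift]
  congr 1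
  · ext q; exact cells_shift
  · funext q; exact read_shift

theorem ap_local (R : Rule c.n) {x y : ℤ → Γ} {z : ℤ}
    (h : ∀ w ∈ Finset.Icc (z - 31 * c.n) (z + 41 * c.n), y w = x w) : c.ap R y z = c.ap R x z := by
  have hn := c.n_pos
  have h' : ∀ w, z - 31 * c.n ≤ w → w ≤ z + 41 * c.n → y w = x w :=
    fun w h1 h2 => h w (Finset.mem_Icc.2 ⟨h1, h2⟩)
  have hocc : ∀ q, z - 31 * c.n ≤ q → q ≤ z + 16 * c.n → ∀ d, c.Occ y q d ↔ c.Occ x q d :=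
    fun q h1 h2 d => cells_congr fun w h3 h4 => h' w (by omega) (by omega)
  have hcell : ∀ q, z - 31 * c.n ≤ q → q ≤ z + 16 * c.n → (q ∈ c.cells y ↔ q ∈ c.cells x) :=
    fun q h1 h2 => exists_congr (hocc q h1 h2)
  unfold ap
  apply write_local (h' z (by omega) (by omega))
  · intro p h1 h2
    exact hcell p (by omega) (by omega)
  · intro p h1 h2
    apply R.loc
    intro q h3 h4
    exact ⟨hcell q (by omega) (by omega), read_congr (hocc q (by omega) (by omega))⟩

theorem ap_continuous [TopologicalSpace Γ] [DiscreteTopology Γ] (R : Rule c.n) :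
    Continuous (c.ap R) := by
  refine continuous_pi fun z => continuous_iff_continuousAt.2 fun x => ?_
  have hev : ∀ᶠ y in nhds x, ∀ w ∈ Finset.Icc (z - 31 * (c.n : ℤ)) (z + 41 * c.n), y w = x w := by
    rw [Filter.eventually_all_finset]
    intro w _
    have h1 : Filter.Tendsto (fun y : ℤ → Γ => y w) (nhds x) (nhds (x w)) :=
      (continuous_apply w).continuousAt
    rw [nhds_discrete Γ] at h1
    exact h1 (show {x w} ∈ pure (x w) from rfl)
  have : ContinuousAt (fun _ : ℤ → Γ => c.ap R x z) x := continuousAt_const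
  refine this.congr ?_
  filter_upwards [hev] with y hy
  exact (ap_local R hy).symm

/-- `y` is obtained from `x` by overwriting data -/
def Sk (c : Code Γ) (x y : ℤ → Γ) : Prop := y = c.write x (c.read y)

theorem Sk.refl (x : ℤ → Γ) : c.Sk x x := (write_read x).symm

theorem Sk.cells {x y : ℤ → Γ} (h : c.Sk x y) : c.cells y = c.cells x := by
  rw [h, cells_write]

theorem Sk.symm {x y : ℤ → Γ} (h : c.Sk x y) : c.Sk y x := by
  unfold Sk at *
  conv_rhs => rw [h, write_write, write_read]

theorem Sk.trans {x y z : ℤ → Γ} (h : c.Sk x y) (h' : c.Sk y z) : c.Sk x z := by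
  unfold Sk at *
  have h2 : c.write y (c.read z) = c.write x (c.read z) := by
    conv_lhs => rw [h, write_write]
  rw [← h2]
  exact h'

theorem Sk.ext {x y : ℤ → Γ} (h : c.Sk x y) (h' : ∀ p ∈ c.cells x, c.read y p = c.read x p) :
    y = x := by
  rw [h, write_congr h', write_read]

theorem Sk.ap (R : Rule c.n) (x : ℤ → Γ) : c.Sk x (c.ap R x) := by
  unfold Sk
  rw [read_ap]
  rfl

/-- the track of top and bottom bits -/
noncomputable def tb (c : Code Γ) (x : ℤ → Γ) : ℤ → Bool × Bool := fun q => (c.read x q).1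

end Code

section Auts

variable {Γ : Type} [TopologicalSpace Γ] [DiscreteTopology Γ] {X : Set (ℤ → Γ)}

noncomputable def aut (c : Code Γ) (hX : ∀ x ∈ X, ∀ d, c.write x d ∈ X) (R R' : Rule c.n)
    (h : R.Undo R') (h' : R'.Undo R) : SubAut X {shiftMapZ Γ} := by
  have hgood : ∀ (f : Equiv.Perm X) (R : Rule c.n), (∀ x, (f x).1 = c.ap R x) →
      GoodPerm {shiftMapZ Γ} f := by
    intro f R hf
    refine ⟨?_, ?_⟩
    · rw [continuous_induced_rng]
      have : (Subtype.val ∘ f : X → ℤ → Γ) = fun x : X => c.ap R x := funext hf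
      rw [this]
      exact (Code.ap_continuous R).comp continuous_subtype_val
    · rintro s rfl x y hxy
      rw [hf, hf, ← hxy]
      exact (Code.ap_shift R _).symm
  refine ⟨⟨fun x => ⟨c.ap R x, hX x x.2 _⟩, fun x => ⟨c.ap R' x, hX x x.2 _⟩, ?_, ?_⟩, ?_, ?_⟩
  · intro x; exact Subtype.ext (Code.ap_undo h _)
  · intro x; exact Subtype.ext (Code.ap_undo h' _)
  · exact hgood _ R fun x => rfl
  · exact hgood _ R' fun x => rfl

variable {c : Code Γ} {hX : ∀ x ∈ X, ∀ d, c.write x d ∈ X}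

theorem aut_apply (R R' : Rule c.n) (h : R.Undo R') (h' : R'.Undo R) (x : X) :
    ((aut c hX R R' h h').1 x).1 = c.ap R x := rfl

/-- the group of position dependent permutations -/
abbrev PG := Set ℤ → (ℤ → Bool × Bool) → ℤ → Equiv.Perm QQ

/-- `f` acts on the `QQ` track through `Φ` -/
def Acts (c : Code Γ) (f : SubAut X {shiftMapZ Γ}) (Φ : PG) : Prop :=
  ∀ x : X, c.Sk x (f.1 x) ∧ ∀ p ∈ c.cells (x : ℤ → Γ), c.read (f.1 x) p =
    (c.tb x p, Φ (c.cells x) (c.tb x) p (c.read x p).2)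

theorem Acts.tb {f : SubAut X {shiftMapZ Γ}} {Φ : PG} (h : Acts c f Φ) (x : X) :
    c.tb (f.1 x) = c.tb x := by
  funext p
  by_cases hp : p ∈ c.cells (x : ℤ → Γ)
  · show (c.read (f.1 x) p).1 = _
    rw [(h x).2 p hp]
  · show (c.read (f.1 x) p).1 = (c.read x p).1
    rw [Code.read_out hp, Code.read_out]
    rwa [(h x).1.cells]

def actsGroup (c : Code Γ) (X : Set (ℤ → Γ)) : Subgroup (SubAut X {shiftMapZ Γ} × PG) where
  carrier := {a | Acts c a.1 a.2}
  one_mem' := fun x => ⟨Code.Sk.refl _, fun p _ => rfl⟩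
  mul_mem' := by
    rintro ⟨f, Φ⟩ ⟨g, Ψ⟩ hf hg x
    have hf : Acts c f Φ := hf
    have hg : Acts c g Ψ := hg
    refine ⟨(hg x).1.trans (hf (g.1 x)).1, fun p hp => ?_⟩
    have h1 := (hf (g.1 x)).2 p (by rwa [(hg x).1.cells])
    rw [hg.tb, (hg x).1.cells, (hg x).2 p hp] at h1
    exact h1
  inv_mem' := by
    rintro ⟨f, Φ⟩ hf x
    have hf : Acts c f Φ := hf
    obtain ⟨y, rfl⟩ := f.1.surjective x
    have hinv : ((f, Φ)⁻¹ : SubAut X {shiftMapZ Γ} × PG).1.1 (f.1 y) = y :=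
      inv_apply_self' _ _
    rw [hinv]
    refine ⟨(hf y).1.symm, fun p hp => ?_⟩
    rw [(hf y).1.cells] at hp
    rw [hf.tb, (hf y).1.cells, (hf y).2 p hp]
    show c.read y p = (c.tb y p, (Φ (c.cells y) (c.tb y) p)⁻¹ (Φ (c.cells y) (c.tb y) p
      (c.read y p).2))
    rw [inv_apply_self']
    rfl

def actsN (c : Code Γ) (X : Set (ℤ → Γ)) : Subgroup (SubAut X {shiftMapZ Γ}) :=
  (actsGroup c X).map (MonoidHom.fst _ _)

theorem mem_actsN {f : SubAut X {shiftMapZ Γ}} : f ∈ actsN c X ↔ ∃ Φ, Acts c f Φ := by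
  constructor
  · rintro ⟨⟨f', Φ⟩, h, rfl⟩
    exact ⟨Φ, h⟩
  · rintro ⟨Φ, h⟩
    exact ⟨(f, Φ), h, rfl⟩

theorem actsN_pow {e : ℕ} (he : ∀ g : Equiv.Perm QQ, g ^ e = 1) {f : SubAut X {shiftMapZ Γ}}
    (hf : f ∈ actsN c X) : f ^ e = 1 := by
  obtain ⟨Φ, h⟩ := mem_actsN.1 hf
  have h1 : (f, Φ) ^ e ∈ actsGroup c X := pow_mem h _
  have h2 : Φ ^ e = 1 := by
    funext s t p
    exact he _
  have h3 : Acts c (f ^ e) 1 := by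
    rw [← h2]
    exact h1
  apply Subtype.ext
  apply Equiv.ext
  intro x
  exact Subtype.ext ((h3 x).1.ext fun p hp => (h3 x).2 p hp)

theorem actsN_conj {A : Rule c.n} (hA : A.Undo A)
    (τ : Set ℤ → (ℤ → Bool × Bool) → ℤ → Bool × Bool)
    (h : ∀ s d p, A.f s d p = (τ s (fun q => (d q).1) p, (d p).2)) {f : SubAut X {shiftMapZ Γ}}
    (hf : f ∈ actsN c X) : aut c hX A A hA hA * f * aut c hX A A hA hA ∈ actsN c X := by
  obtain ⟨Φ, hf⟩ := mem_actsN.1 hf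
  refine mem_actsN.2 ⟨fun s t p => Φ s (τ s t) p, fun x => ?_⟩
  set a := aut c hX A A hA hA
  have hsk : ∀ x : X, c.Sk x (a.1 x) := fun x => Code.Sk.ap _ _
  have htb : ∀ x : X, c.tb (a.1 x) = τ (c.cells x) (c.tb x) := by
    intro x
    funext p
    show (c.read (c.ap A x) p).1 = _
    rw [Code.read_ap, h]
    rfl
  have hq : ∀ (x : X) p, (c.read (a.1 x) p).2 = (c.read x p).2 := by
    intro x p
    show (c.read (c.ap A x) p).2 = _
    rw [Code.read_ap, h]
  have haa : a.1 (a.1 x) = x := Subtype.ext (Code.ap_undo hA _)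
  show c.Sk x (a.1 (f.1 (a.1 x))) ∧ ∀ p ∈ c.cells x, c.read (a.1 (f.1 (a.1 x))) p = _
  refine ⟨((hsk x).trans (hf _).1).trans (hsk _), fun p hp => ?_⟩
  refine Prod.ext ?_ ?_
  · have h1 : c.tb (a.1 (f.1 (a.1 x))) = c.tb x := by
      rw [htb, hf.tb, (hf _).1.cells, ← htb, haa]
    exact congrFun h1 p
  · rw [hq, (hf _).2 p (by rwa [(hsk x).cells]), hq, htb, (hsk x).cells]

/-- Good points -/
def Good (c : Code Γ) (s0 : Set ℤ) (t0 : ℤ → Bool × Bool) (x : ℤ → Γ) : Prop :=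
  c.cells x = s0 ∧ c.tb x = t0

def relGroup (c : Code Γ) (X : Set (ℤ → Γ)) (s0 : Set ℤ) (t0 : ℤ → Bool × Bool) :
    Subgroup (SubAut X {shiftMapZ Γ} × Equiv.Perm QQ) where
  carrier := {a | ∀ x : X, (Good c s0 t0 x ↔ Good c s0 t0 (a.1.1 x)) ∧
    (Good c s0 t0 x → (c.read (a.1.1 x) 0).2 = a.2 (c.read x 0).2)}
  one_mem' := fun x => ⟨Iff.rfl, fun _ => rfl⟩
  mul_mem' := by
    rintro ⟨f, s⟩ ⟨g, t⟩ hf hg x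
    refine ⟨(hg x).1.trans (hf (g.1 x)).1, fun hx => ?_⟩
    have h1 := (hf (g.1 x)).2 ((hg x).1.1 hx)
    have h2 := (hg x).2 hx
    simp only at h1 h2
    rw [h2] at h1
    exact h1
  inv_mem' := by
    rintro ⟨f, s⟩ hf x
    obtain ⟨y, rfl⟩ := f.1.surjective x
    have hinv : ((f, s)⁻¹ : SubAut X {shiftMapZ Γ} × Equiv.Perm QQ).1.1 (f.1 y) = y :=
      inv_apply_self' _ _
    rw [hinv]
    refine ⟨(hf y).1.symm, fun hx => ?_⟩
    have h1 := (hf y).2 ((hf y).1.2 hx)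
    simp only at h1
    rw [h1]
    exact (inv_apply_self' s _).symm

end Auts

/-! ### The concrete rules -/

def alphaR (n : ℕ) : Rule n where
  f := fun _ d p => (((d p).1.2, (d p).1.1), (d p).2)
  norm := by
    intro s d p _ h
    rw [h]; rfl
  shift := fun _ _ _ => rfl
  loc := by
    intro s s' d d' p h
    rw [(h p (by omega) (by omega)).2]

open Classical in
noncomputable def betaT (n : ℕ) (s : Set ℤ) (t : ℤ → Bool × Bool) (p : ℤ) : Bool × Bool :=
  (if p ∈ s ∧ p - 16 * n ∈ s then (t (p - 16 * n)).2 else (t p).1,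
    if p ∈ s ∧ p + 16 * n ∈ s then (t (p + 16 * n)).1 else (t p).2)

noncomputable def betaR (n : ℕ) : Rule n where
  f := fun s d p => (betaT n s (fun q => (d q).1) p, (d p).2)
  norm := by
    intro s d p hp h
    simp [betaT, hp, h, d0]
  shift := by
    intro s d p
    have e1 : p - 16 * n + 1 = p + 1 - 16 * n := by ring
    have e2 : p + 16 * n + 1 = p + 1 + 16 * n := by ring
    classical
    refine Prod.ext (Prod.ext (if_congr ?_ ?_ rfl) (if_congr ?_ ?_ rfl)) rfl
    · show p + 1 ∈ s ∧ p - 16 * n + 1 ∈ s ↔ _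
      rw [e1]
    · show (d (p - 16 * n + 1)).1.2 = _
      rw [e1]
    · show p + 1 ∈ s ∧ p + 16 * n + 1 ∈ s ↔ _
      rw [e2]
    · show (d (p + 16 * n + 1)).1.1 = _
      rw [e2]
  loc := by
    intro s s' d d' p h
    have h1 := h p (by omega) (by omega)
    have h2 := h (p - 16 * n) (by omega) (by omega)
    have h3 := h (p + 16 * n) (by omega) (by omega)
    classical
    refine Prod.ext (Prod.ext (if_congr (and_congr h1.1 h2.1) ?_ ?_)
      (if_congr (and_congr h1.1 h3.1) ?_ ?_)) ?_
    · exact congrArg (fun e : DD => e.1.2) h2.2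
    · exact congrArg (fun e : DD => e.1.1) h1.2
    · exact congrArg (fun e : DD => e.1.1) h3.2
    · exact congrArg (fun e : DD => e.1.2) h1.2
    · show (d p).2 = (d' p).2
      rw [h1.2]

def gR (n : ℕ) (g : Equiv.Perm QQ) : Rule n where
  f := fun _ d p => if (d p).1.1 then ((d p).1, g (d p).2) else d p
  norm := by
    intro s d p _ h
    rw [h]; rfl
  shift := fun _ _ _ => rfl
  loc := by
    intro s s' d d' p h
    rw [(h p (by omega) (by omega)).2]

theorem alpha_undo (n : ℕ) : (alphaR n).Undo (alphaR n) := fun _ _ _ => rfl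

theorem beta_undo (n : ℕ) : (betaR n).Undo (betaR n) := by
  intro s d _
  funext p
  refine Prod.ext (Prod.ext ?_ ?_) rfl
  · simp only [betaR, betaT]
    by_cases h : p ∈ s ∧ p - 16 * n ∈ s
    · simp [h]
    · simp only [h, if_false]
  · simp only [betaR, betaT]
    by_cases h : p ∈ s ∧ p + 16 * n ∈ s
    · simp [h]
    · simp only [h, if_false]

theorem g_undo (n : ℕ) {g h : Equiv.Perm QQ} (hgh : h * g = 1) : (gR n g).Undo (gR n h) := by
  intro s d _
  funext p
  have h1 : h (g (d p).2) = (d p).2 := by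
    rw [← Equiv.Perm.mul_apply, hgh]; rfl
  simp only [gR]
  by_cases hp : (d p).1.1 = true
  · simp [hp, h1]
  · simp [hp]

theorem main {Γ F : Type} [TopologicalSpace Γ] [DiscreteTopology Γ] {L : Language Γ}
    (P : Profile L F) (hB : Branch P) :
    ∃ H : Subgroup (SubAut (SX L) {shiftMapZ Γ}), H.FG ∧
      (¬∃ K : Subgroup H, K.FiniteIndex ∧ Group.IsSolvable K) ∧
      ¬∃ K : Subgroup H, Nonempty (K ≃* FreeGroup (Fin 2)) := by
  obtain ⟨c, hP, hk⟩ := exists_code P hB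
  obtain ⟨x0, hx0, hcells⟩ := Code.exists_base P hP hk
  have hX : ∀ x ∈ SX L, ∀ d, c.write x d ∈ SX L := fun x hx d => Code.write_mem P hP hx d
  let α := aut c hX (alphaR c.n) (alphaR c.n) (alpha_undo _) (alpha_undo _)
  let β := aut c hX (betaR c.n) (betaR c.n) (beta_undo _) (beta_undo _)
  let σ : Equiv.Perm QQ → SubAut (SX L) {shiftMapZ Γ} := fun g =>
    aut c hX (gR c.n g) (gR c.n g⁻¹) (g_undo _ (inv_mul_cancel g)) (g_undo _ (mul_inv_cancel g))
  have hα : α * α = 1 := by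
    apply Subtype.ext; apply Equiv.ext; intro x
    exact Subtype.ext (Code.ap_undo (alpha_undo _) _)
  have hβ : β * β = 1 := by
    apply Subtype.ext; apply Equiv.ext; intro x
    exact Subtype.ext (Code.ap_undo (beta_undo _) _)
  have hNα : ∀ f ∈ actsN c (SX L), α * f * α ∈ actsN c (SX L) := fun f hf =>
    actsN_conj (alpha_undo _) (fun _ t p => ((t p).2, (t p).1)) (fun _ _ _ => rfl) hf
  have hNβ : ∀ f ∈ actsN c (SX L), β * f * β ∈ actsN c (SX L) := fun f hf =>
    actsN_conj (beta_undo _) (betaT c.n) (fun _ _ _ => rfl) hf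
  have hσread : ∀ g (x : SX L) p, c.read ((σ g).1 x) p =
      (c.tb x p, (if (c.tb x p).1 then g else 1) (c.read x p).2) := by
    intro g x p
    show c.read (c.ap _ x) p = _
    rw [Code.read_ap]
    simp only [gR, Code.tb]
    by_cases h : (c.read x p).1.1 = true
    · simp [h]
    · simp [h]
  have hσN : ∀ g, σ g ∈ actsN c (SX L) := fun g =>
    mem_actsN.2 ⟨fun _ t p => if (t p).1 then g else 1, fun x => ⟨Code.Sk.ap _ _,
      fun p _ => hσread g x p⟩⟩
  have hS : Set.range σ ⊆ actsN c (SX L) := by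
    rintro _ ⟨g, rfl⟩
    exact hσN g
  refine ⟨Subgroup.closure ({α, β} ∪ Set.range σ), ?_, ?_, ?_⟩
  · exact (Subgroup.fg_iff _).2 ⟨_, rfl, (Set.toFinite _).union (Set.finite_range _)⟩
  · let t0 : ℤ → Bool × Bool := fun p => (decide (p = 0), false)
    have h0 : (0 : ℤ) ∈ c.cells x0 := by simpa using hcells 0
    have hαm : α ∈ Subgroup.closure ({α, β} ∪ Set.range σ) := Subgroup.subset_closure (by simp)
    have hβm : β ∈ Subgroup.closure ({α, β} ∪ Set.range σ) := Subgroup.subset_closure (by simp)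
    have hα' : α⁻¹ = α := inv_eq_of_mul_eq_one_left hα
    have hβ' : β⁻¹ = β := inv_eq_of_mul_eq_one_left hβ
    -- the Q track and the cells are preserved by both involutions
    have hcα : ∀ x : SX L, c.cells (α.1 x) = c.cells x := fun x => Code.cells_ap _ _
    have hcβ : ∀ x : SX L, c.cells (β.1 x) = c.cells x := fun x => Code.cells_ap _ _
    have hqα : ∀ (x : SX L) p, (c.read (α.1 x) p).2 = (c.read x p).2 := by
      intro x p
      show (c.read (c.ap _ x) p).2 = _
      rw [Code.read_ap]; rfl
    have hqβ : ∀ (x : SX L) p, (c.read (β.1 x) p).2 = (c.read x p).2 := by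
      intro x p
      show (c.read (c.ap _ x) p).2 = _
      rw [Code.read_ap]; rfl
    have hqρ : ∀ (r : ℕ) (x : SX L) p,
        (c.read (((β * α) ^ r).1 x) p).2 = (c.read x p).2 := by
      intro r
      induction r with
      | zero => intro x p; rfl
      | succ r ih =>
        intro x p
        rw [pow_succ]
        show (c.read (((β * α) ^ r).1 (β.1 (α.1 x))) p).2 = _
        rw [ih, hqβ, hqα]
    -- the top track moves
    have hT : ∀ (x : SX L) p, p ∈ c.cells (x : ℤ → Γ) → p + 16 * c.n ∈ c.cells (x : ℤ → Γ) →
        (c.tb (α.1 (β.1 x)) p).1 = (c.tb x (p + 16 * c.n)).1 := by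
      intro x p h1 h2
      show (c.read (c.ap _ (c.ap _ x)) p).1.1 = _
      rw [Code.read_ap, Code.read_ap]
      simp only [alphaR, betaR, betaT, h1, h2, and_self, if_true]
      rfl
    have hTr : ∀ (r : ℕ) (x : SX L), (∀ i : ℤ, i * (16 * c.n) ∈ c.cells (x : ℤ → Γ)) →
        ∀ i : ℤ, (c.tb (((β * α) ^ r)⁻¹.1 x) (i * (16 * c.n))).1 =
          (c.tb x ((i + r) * (16 * c.n))).1 := by
      intro r
      induction r with
      | zero => intro x _ i; simp
      | succ r ih =>
        intro x hx i
        have h1 : ((β * α) ^ (r + 1))⁻¹ = ((β * α) ^ r)⁻¹ * (α * β) := by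
          rw [pow_succ', mul_inv_rev, mul_inv_rev, hα', hβ']
        rw [h1]
        show (c.tb (((β * α) ^ r)⁻¹.1 (α.1 (β.1 x))) _).1 = _
        rw [ih _ (by rw [hcα, hcβ]; exact hx), hT x _ (hx _)]
        · congr 2
          push_cast
          ring
        · have := hx (i + r + 1)
          rwa [add_mul, one_mul] at this
    have hρN : ∀ (r : ℕ), ∀ f ∈ actsN c (SX L), (β * α) ^ r * f * ((β * α) ^ r)⁻¹ ∈
        actsN c (SX L) := by
      intro r
      induction r with
      | zero => intro f hf; simpa using hf
      | succ r ih =>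
        intro f hf
        have h1 : (β * α) ^ (r + 1) * f * ((β * α) ^ (r + 1))⁻¹ =
            β * (α * ((β * α) ^ r * f * ((β * α) ^ r)⁻¹) * α) * β := by
          rw [pow_succ', mul_inv_rev, mul_inv_rev, hα', hβ']
          simp only [mul_assoc]
        rw [h1]
        exact hNβ _ (hNα _ (ih f hf))
    have hgoodN : ∀ f ∈ actsN c (SX L), ∀ x : SX L,
        Good c (c.cells x0) t0 x ↔ Good c (c.cells x0) t0 (f.1 x) := by
      intro f hf x
      obtain ⟨Φ, hf⟩ := mem_actsN.1 hf
      unfold Good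
      rw [hf.tb, (hf x).1.cells]
    refine not_virtually_solvable (Q := QQ) ?_ _ (β * α) (mul_mem hβm hαm) σ
      (fun g => Subgroup.subset_closure (Or.inr ⟨g, rfl⟩)) (relGroup c (SX L) (c.cells x0) t0)
      ?_ ?_ ?_
    · have : Cardinal.mk QQ = 8 := by simp
      rw [this]; norm_num
    · intro s hs
      apply Equiv.ext
      intro q
      classical
      let d : ℤ → DD := fun p => if p = 0 then ((true, false), q) else d0
      have h1 := (hs ⟨c.write x0 d, hX _ hx0 _⟩).2 ⟨Code.cells_write _ _, by
        funext p
        show (c.read (c.write x0 d) p).1 = _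
        by_cases hp : p ∈ c.cells x0
        · rw [Code.read_write _ hp]
          by_cases hp0 : p = 0
          · simp [d, hp0, t0]
          · simp [d, hp0, t0, d0]
        · rw [Code.read_out (by simpa using hp)]
          have : p ≠ 0 := fun h => hp (h ▸ h0)
          simp [t0, this, d0]⟩
      have h2 : (c.read (c.write x0 d) 0).2 = q := by
        rw [Code.read_write _ h0]
        simp [d]
      have h3 : (c.read (c.write x0 d) 0).2 = s (c.read (c.write x0 d) 0).2 := h1
      rw [h2] at h3
      exact h3.symm
    · intro g x
      refine ⟨hgoodN _ (hσN g) x, fun hx => ?_⟩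
      have h1 := hσread g x 0
      rw [hx.2] at h1
      show (c.read ((σ g).1 x) 0).2 = _
      rw [h1]
      simp [t0]
    · intro g r hr x
      refine ⟨hgoodN _ (hρN r _ (hσN g)) x, fun hx => ?_⟩
      show (c.read (((β * α) ^ r).1 ((σ g).1 (((β * α) ^ r)⁻¹.1 x))) 0).2 = (c.read x 0).2
      have h1 : (c.tb (((β * α) ^ r)⁻¹.1 x) 0).1 = false := by
        have := hTr r x (by rw [hx.1]; exact hcells) 0
        rw [zero_mul, hx.2] at this
        rw [this]
        have hn := c.n_pos
        have : ((0 : ℤ) + r) * (16 * c.n) ≠ 0 := by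
          have h2 : (r : ℤ) ≠ 0 := by omega
          have h3 : (c.n : ℤ) ≠ 0 := by omega
          rw [zero_add]
          exact mul_ne_zero h2 (mul_ne_zero (by norm_num) h3)
        simp only [t0, this, decide_false]
      rw [hqρ, hσread, h1]
      have h2 := hqρ r (((β * α) ^ r)⁻¹.1 x) 0
      have h3 : ((β * α) ^ r).1 (((β * α) ^ r)⁻¹.1 x) = x := apply_inv_self' _ _
      rw [h3] at h2
      simpa using h2.symm
  · rintro ⟨K, hK⟩
    exact no_free hα hβ (actsN c (SX L)) hNα hNβ (Fintype.card_ne_zero (α := Equiv.Perm QQ))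
      (fun n hn => actsN_pow (fun _ => pow_card_eq_one) hn) hS K hK

end TitsCA

theorem stmt11 (Γ : Type) [Fintype Γ] [TopologicalSpace Γ] [DiscreteTopology Γ]
    (X : Set (ℤ → Γ)) (hX : IsSoficShift X) (hunc : ¬X.Countable) :
    ∃ H : Subgroup (SubAut X {shiftMapZ Γ}), H.FG ∧
      (¬∃ K : Subgroup H, K.FiniteIndex ∧ IsSolvable K) ∧
      ¬∃ K : Subgroup H, Nonempty (K ≃* FreeGroup (Fin 2)) := by
  obtain ⟨-, -, L, hL, hXL⟩ := hX
  obtain ⟨F, hF, ⟨P⟩⟩ := TitsCA.exists_profile hL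
  have hSX : X = TitsCA.SX L := by
    have hword : ∀ (x : ℤ → Γ) (i : ℤ) (k : ℕ),
        ((List.range (k + 1)).map fun t : ℕ => x (i + t)) = TitsCA.word x i (k + 1) := by
      intro x i k
      rfl
    rw [hXL]
    ext x
    constructor
    · rintro hx i k ⟨a, b, c, h, hb, hbL⟩
      obtain ⟨m, hm⟩ := Nat.exists_eq_succ_of_ne_zero (mt List.length_eq_zero_iff.1 hb)
      have hlen := congrArg List.length h
      simp only [TitsCA.word_length, List.length_append] at hlen
      rw [hlen, TitsCA.word_add, TitsCA.word_add] at h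
      have h1 := (List.append_inj h (by simp)).1
      have h2 := (List.append_inj h1 (by simp)).2
      apply hx (i + a.length) m
      rw [hword, ← Nat.succ_eq_add_one, ← hm, h2]
      exact hbL
    · intro hx i k hmem
      rw [hword] at hmem
      exact hx i (k + 1) ⟨[], _, [], by simp, by
        intro h0
        have := congrArg List.length h0
        simp at this, hmem⟩
  subst hSX
  have hB : TitsCA.Branch P := by
    by_contra hcon
    exact hunc (TitsCA.countable_of_not_branch P hcon)
  exact TitsCA.main P hB
end
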